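/- Let η₁,…,η₆ be the six odd analytic theta characteristics in dimension g = 2. For every pair of distinct indices k, l ∈ {1,…,6} there exists a sign ε ∈ {+1, −1} such that for all τ in the Siegel upper half-space H₂ one has J(η_k, η_l)(τ) = ε · π² · ∏_{m ∈ {1,…,6}, m ≠ k, l} θ[η_k + η_l − η_m](0; τ), where the characteristics η_k + η_l − η_m are computed entrywise modulo 1 (so have entries in {0, 1/2}). -/

import Mathlib

open scoped Classical BigOperators

noncomputable section

/-- An analytic theta characteristic in dimension `g`: a pair `[η'; η'']` of
vectors in `ℝ^g` (whose entries are intended to lie in `{0, 1/2}`). -/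
abbrev ThetaChar (g : ℕ) : Type := (Fin g → ℝ) × (Fin g → ℝ)

/-- All entries of both vectors of the characteristic lie in `{0, 1/2}`. -/
def IsChar {g : ℕ} (η : ThetaChar g) : Prop :=
  (∀ i, η.1 i = 0 ∨ η.1 i = 1 / 2) ∧ (∀ i, η.2 i = 0 ∨ η.2 i = 1 / 2)

/-- Membership in the Siegel upper half-space `H_g`: a symmetric complex `g×g`
matrix whose imaginary part is positive definite. -/
def IsSiegel {g : ℕ} (τ : Matrix (Fin g) (Fin g) ℂ) : Prop :=
  τ.IsSymm ∧ (τ.map Complex.im).PosDef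

/-- The theta function with characteristic `η`:
`θ[η](z;τ) = ∑_{n ∈ ℤ^g} exp(πi·ᵗ(n+η')τ(n+η') + 2πi·ᵗ(n+η')(z+η''))`. -/
def theta {g : ℕ} (η : ThetaChar g) (z : Fin g → ℂ)
    (τ : Matrix (Fin g) (Fin g) ℂ) : ℂ :=
  ∑' n : Fin g → ℤ,
    Complex.exp
      ((Real.pi : ℂ) * Complex.I *
          ∑ i, ∑ j, ((n i : ℂ) + (η.1 i : ℂ)) * τ i j * ((n j : ℂ) + (η.1 j : ℂ)) +
        2 * (Real.pi : ℂ) * Complex.I *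
          ∑ i, ((n i : ℂ) + (η.1 i : ℂ)) * (z i + (η.2 i : ℂ)))

/-- `η` is an even characteristic: `4·ᵗη'η''` is an even integer. -/
def IsEvenChar {g : ℕ} (η : ThetaChar g) : Prop :=
  ∃ k : ℤ, (4 * ∑ i, η.1 i * η.2 i : ℝ) = 2 * (k : ℝ)

/-- `η` is an odd characteristic. -/
def IsOddChar {g : ℕ} (η : ThetaChar g) : Prop := ¬ IsEvenChar η

/-- Entrywise sum of two characteristics, taken modulo 1. -/
def charAdd {g : ℕ} (η ζ : ThetaChar g) : ThetaChar g :=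
  (fun i => Int.fract (η.1 i + ζ.1 i), fun i => Int.fract (η.2 i + ζ.2 i))

/-- Entrywise difference of two characteristics, taken modulo 1. -/
def charSub {g : ℕ} (η ζ : ThetaChar g) : ThetaChar g :=
  (fun i => Int.fract (η.1 i - ζ.1 i), fun i => Int.fract (η.2 i - ζ.2 i))

/-- The Jacobian Nullwert `J(η₁,…,η_g)(τ)`: the determinant of the matrix of
partial derivatives `∂θ[η_k]/∂z_l` at `z = 0`. -/
def jacobianNullwert {g : ℕ} (η : Fin g → ThetaChar g)
    (τ : Matrix (Fin g) (Fin g) ℂ) : ℂ :=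
  Matrix.det (Matrix.of fun k l : Fin g =>
    fderiv ℂ (fun z : Fin g → ℂ => theta (η k) z τ) 0 (Pi.single l 1))

/-- The characteristic `[a/2; b/2]` attached to integers `a₀, a₁, b₀, b₁`. -/
def halfChar (a₀ a₁ b₀ b₁ : ℤ) : ThetaChar 2 :=
  (![(a₀ : ℝ) / 2, (a₁ : ℝ) / 2], ![(b₀ : ℝ) / 2, (b₁ : ℝ) / 2])

/-- The quadratic form of a `2 × 2` matrix. -/
def quadForm (τ : Matrix (Fin 2) (Fin 2) ℂ) (x y : ℂ) : ℂ :=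
  x * τ 0 0 * x + x * τ 0 1 * y + (y * τ 1 0 * x + y * τ 1 1 * y)

/-- The general term of the theta series with characteristic `[a/2; b/2]`. -/
def thetaTerm (a₀ a₁ b₀ b₁ : ℤ) (τ : Matrix (Fin 2) (Fin 2) ℂ) (z : Fin 2 → ℂ) (n : ℤ × ℤ) : ℂ :=
  Complex.exp ((Real.pi : ℂ) * Complex.I * quadForm τ (n.1 + a₀ / 2) (n.2 + a₁ / 2) +
    2 * (Real.pi : ℂ) * Complex.I *
      ((n.1 + a₀ / 2) * (z 0 + b₀ / 2) + (n.2 + a₁ / 2) * (z 1 + b₁ / 2)))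

/-- The imaginary part of the quadratic form is positive definite. -/
def PosIm (τ : Matrix (Fin 2) (Fin 2) ℂ) : Prop :=
  ∃ c : ℝ, 0 < c ∧ ∀ x y : ℝ, c * (x ^ 2 + y ^ 2) ≤ (quadForm τ x y).im

/-- The size of a lattice point, as used in the majorants. -/
def latticeSize (n : ℤ × ℤ) : ℝ := 1 + |(n.1 : ℝ)| + |(n.2 : ℝ)|

lemma one_le_latticeSize (n : ℤ × ℤ) : 1 ≤ latticeSize n := by
  unfold latticeSize
  have := abs_nonneg (n.1 : ℝ)
  have := abs_nonneg (n.2 : ℝ)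
  linarith

lemma IsSiegel.posIm {τ : Matrix (Fin 2) (Fin 2) ℂ} (h : IsSiegel τ) : PosIm τ := by
  obtain ⟨hs, hp⟩ := h
  have h0 : 0 < (τ 0 0).im := by simpa using hp.diag_pos (i := 0)
  have h1 : 0 < (τ 1 1).im := by simpa using hp.diag_pos (i := 1)
  have hd := hp.det_pos
  rw [Matrix.det_fin_two] at hd
  simp only [Matrix.map_apply] at hd
  have h01 : τ 1 0 = τ 0 1 := hs.apply 0 1
  rw [h01] at hd
  set p := (τ 0 0).im
  set q := (τ 0 1).im
  set r := (τ 1 1).im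
  refine ⟨(p * r - q * q) / (p + r), by positivity, fun x y => ?_⟩
  have hq : (quadForm τ x y).im = p * x ^ 2 + 2 * q * (x * y) + r * y ^ 2 := by
    simp only [quadForm, h01, Complex.add_im, Complex.mul_im, Complex.mul_re, Complex.ofReal_re,
      Complex.ofReal_im]
    ring
  rw [hq, div_mul_eq_mul_div, div_le_iff₀ (by positivity)]
  nlinarith [sq_nonneg (p * x + q * y), sq_nonneg (q * x + r * y)]

lemma theta_halfChar (a₀ a₁ b₀ b₁ : ℤ) (z : Fin 2 → ℂ) (τ : Matrix (Fin 2) (Fin 2) ℂ) :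
    theta (halfChar a₀ a₁ b₀ b₁) z τ = ∑' n : ℤ × ℤ, thetaTerm a₀ a₁ b₀ b₁ τ z n := by
  rw [theta, ← (finTwoArrowEquiv ℤ).tsum_eq]
  refine tsum_congr fun n => ?_
  simp [thetaTerm, quadForm, halfChar, Fin.sum_univ_two, finTwoArrowEquiv]

lemma norm_thetaTerm (a₀ a₁ b₀ b₁ : ℤ) (τ : Matrix (Fin 2) (Fin 2) ℂ) (z : Fin 2 → ℂ)
    (n : ℤ × ℤ) :
    ‖thetaTerm a₀ a₁ b₀ b₁ τ z n‖ =
      Real.exp (-Real.pi * (quadForm τ ((n.1 + a₀ / 2 : ℝ) : ℂ) ((n.2 + a₁ / 2 : ℝ) : ℂ)).im -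
        2 * Real.pi * ((n.1 + a₀ / 2) * (z 0).im + (n.2 + a₁ / 2) * (z 1).im)) := by
  rw [thetaTerm, Complex.norm_exp]
  congr 1
  push_cast
  have e : ∀ w : ℂ, ((Real.pi : ℂ) * Complex.I * w).re = -Real.pi * w.im := by
    intro w; simp
  have e2 : ∀ w : ℂ, (2 * (Real.pi : ℂ) * Complex.I * w).re = -(2 * Real.pi * w.im) := by
    intro w; simp
  have e3 : ∀ (m a b : ℤ) (w : ℂ),
      (((m : ℂ) + a / 2) * (w + b / 2)).im = ((m : ℝ) + a / 2) * w.im := by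
    intro m a b w
    have h1 : (m : ℂ) + a / 2 = (((m : ℝ) + a / 2 : ℝ) : ℂ) := by push_cast; rfl
    have h2 : (b : ℂ) / 2 = (((b : ℝ) / 2 : ℝ) : ℂ) := by push_cast; rfl
    rw [h1, h2, Complex.im_ofReal_mul, Complex.add_im,
      Complex.ofReal_im, add_zero]
  rw [Complex.add_re, e, e2, Complex.add_im, e3, e3]
  ring

lemma summable_exp_neg_abs : Summable fun n : ℤ => Real.exp (-|(n : ℝ)|) := by
  rw [summable_int_iff_summable_nat_and_neg]
  constructor <;> simpa using Real.summable_exp_neg_nat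

lemma summable_exp_neg_latticeSize :
    Summable fun n : ℤ × ℤ => Real.exp (-latticeSize n) := by
  have h := (summable_exp_neg_abs.mul_of_nonneg summable_exp_neg_abs
    (fun _ => (Real.exp_pos _).le) (fun _ => (Real.exp_pos _).le)).mul_left (Real.exp (-1))
  refine h.congr fun n => ?_
  rw [← Real.exp_add, ← Real.exp_add]
  congr 1
  unfold latticeSize
  ring

lemma neg_sq_add_abs_le {α β : ℝ} (hα : 0 < α) (x : ℝ) :
    -α * x ^ 2 + β * |x| ≤ β ^ 2 / (4 * α) := by
  rw [le_div_iff₀ (by positivity), ← sq_abs x]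
  nlinarith [sq_nonneg (2 * α * |x| - β)]

/-- Locally uniform exponential decay of the theta series, with a linear weight. -/
lemma exists_bound_thetaTerm {τ : Matrix (Fin 2) (Fin 2) ℂ} (hτ : PosIm τ) (a₀ a₁ b₀ b₁ : ℤ)
    (R : ℝ) :
    ∃ C : ℝ, 0 ≤ C ∧ ∀ z : Fin 2 → ℂ, ‖z‖ ≤ R → ∀ n : ℤ × ℤ,
      latticeSize n * ‖thetaTerm a₀ a₁ b₀ b₁ τ z n‖ ≤ C * Real.exp (-latticeSize n) := by
  obtain ⟨c, hc, h⟩ := hτ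
  set α := Real.pi * c with hα_def
  have hα : 0 < α := by have := Real.pi_pos; positivity
  set β := 2 * Real.pi * R + 2 with hβ_def
  refine ⟨Real.exp (2 * (β ^ 2 / (4 * α)) + |(a₀ : ℝ)| + |(a₁ : ℝ)| + 2), (Real.exp_pos _).le,
    fun z hz n => ?_⟩
  have hL : latticeSize n ≤ Real.exp (latticeSize n) := by
    linarith [Real.add_one_le_exp (latticeSize n)]
  refine (mul_le_mul_of_nonneg_right hL (norm_nonneg _)).trans ?_
  rw [norm_thetaTerm, ← Real.exp_add, ← Real.exp_add]
  apply Real.exp_le_exp.2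
  set x : ℝ := n.1 + a₀ / 2 with hx
  set y : ℝ := n.2 + a₁ / 2 with hy
  have h1 := h x y
  have h2 := neg_sq_add_abs_le (β := β) hα x
  have h3 := neg_sq_add_abs_le (β := β) hα y
  have hz0 : |(z 0).im| ≤ R := (Complex.abs_im_le_norm _).trans ((norm_le_pi_norm z 0).trans hz)
  have hz1 : |(z 1).im| ≤ R := (Complex.abs_im_le_norm _).trans ((norm_le_pi_norm z 1).trans hz)
  have hx0 : -(x * (z 0).im) ≤ |x| * R := by
    refine (neg_le_abs _).trans ?_
    rw [abs_mul]; gcongr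
  have hy0 : -(y * (z 1).im) ≤ |y| * R := by
    refine (neg_le_abs _).trans ?_
    rw [abs_mul]; gcongr
  have hn1 : |(n.1 : ℝ)| ≤ |x| + |(a₀ : ℝ)| / 2 := by
    have : (n.1 : ℝ) = x - a₀ / 2 := by rw [hx]; ring
    rw [this]
    refine (abs_sub _ _).trans ?_
    rw [abs_div, abs_two]
  have hn2 : |(n.2 : ℝ)| ≤ |y| + |(a₁ : ℝ)| / 2 := by
    have : (n.2 : ℝ) = y - a₁ / 2 := by rw [hy]; ring
    rw [this]
    refine (abs_sub _ _).trans ?_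
    rw [abs_div, abs_two]
  have hq : -Real.pi * (quadForm τ x y).im ≤ -α * x ^ 2 + -α * y ^ 2 := by
    have := mul_le_mul_of_nonneg_left h1 Real.pi_pos.le
    rw [hα_def]; linarith
  have hl : -(2 * Real.pi * (x * (z 0).im + y * (z 1).im)) ≤
      2 * Real.pi * R * |x| + 2 * Real.pi * R * |y| := by
    have := mul_le_mul_of_nonneg_left (add_le_add hx0 hy0) (by positivity : 0 ≤ 2 * Real.pi)
    linarith
  unfold latticeSize
  rw [hβ_def] at h2 h3
  linarith

lemma summable_latticeSize_mul_norm {τ : Matrix (Fin 2) (Fin 2) ℂ} (hτ : PosIm τ)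
    (a₀ a₁ b₀ b₁ : ℤ) (z : Fin 2 → ℂ) :
    Summable fun n => latticeSize n * ‖thetaTerm a₀ a₁ b₀ b₁ τ z n‖ := by
  obtain ⟨C, -, h⟩ := exists_bound_thetaTerm hτ a₀ a₁ b₀ b₁ ‖z‖
  exact Summable.of_nonneg_of_le
    (fun n => mul_nonneg (zero_le_one.trans (one_le_latticeSize n)) (norm_nonneg _))
    (h z le_rfl) (summable_exp_neg_latticeSize.mul_left C)

lemma summable_norm_thetaTerm {τ : Matrix (Fin 2) (Fin 2) ℂ} (hτ : PosIm τ)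
    (a₀ a₁ b₀ b₁ : ℤ) (z : Fin 2 → ℂ) :
    Summable fun n => ‖thetaTerm a₀ a₁ b₀ b₁ τ z n‖ :=
  Summable.of_nonneg_of_le (fun _ => norm_nonneg _)
    (fun n => le_mul_of_one_le_left (norm_nonneg _) (one_le_latticeSize n))
    (summable_latticeSize_mul_norm hτ a₀ a₁ b₀ b₁ z)

/-- The coefficients of the differential of the general term in `z`. -/
def derivCoeff (a₀ a₁ : ℤ) (n : ℤ × ℤ) (l : Fin 2) : ℂ :=
  2 * (Real.pi : ℂ) * Complex.I * (![n.1 + a₀ / 2, n.2 + a₁ / 2] : Fin 2 → ℂ) l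

/-- The linear form with coefficients `derivCoeff`. -/
def derivForm (a₀ a₁ : ℤ) (n : ℤ × ℤ) : (Fin 2 → ℂ) →L[ℂ] ℂ :=
  derivCoeff a₀ a₁ n 0 • ContinuousLinearMap.proj 0 +
    derivCoeff a₀ a₁ n 1 • ContinuousLinearMap.proj 1

lemma norm_derivCoeff_le (a₀ a₁ : ℤ) (n : ℤ × ℤ) (l : Fin 2) :
    ‖derivCoeff a₀ a₁ n l‖ ≤ 2 * Real.pi * (1 + |(a₀ : ℝ)| + |(a₁ : ℝ)|) * latticeSize n := by
  have key : ∀ m a : ℤ, ‖(m : ℂ) + a / 2‖ ≤ |(m : ℝ)| + |(a : ℝ)| := by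
    intro m a
    refine (norm_add_le _ _).trans ?_
    rw [norm_div, Complex.norm_intCast, Complex.norm_intCast]
    have := abs_nonneg (a : ℝ)
    simp only [Complex.norm_ofNat]
    linarith
  have h0 := abs_nonneg (a₀ : ℝ)
  have h1 := abs_nonneg (a₁ : ℝ)
  have h2 := abs_nonneg (n.1 : ℝ)
  have h3 := abs_nonneg (n.2 : ℝ)
  rw [derivCoeff, norm_mul, mul_assoc (2 * Real.pi)]
  have hc : ‖2 * (Real.pi : ℂ) * Complex.I‖ = 2 * Real.pi := by
    simp [abs_of_pos Real.pi_pos]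
  rw [hc]
  refine mul_le_mul_of_nonneg_left ?_ (by positivity)
  unfold latticeSize
  fin_cases l
  · refine (key n.1 a₀).trans ?_
    nlinarith [mul_nonneg h0 h2, mul_nonneg h0 h3, mul_nonneg h1 h2, mul_nonneg h1 h3]
  · refine (key n.2 a₁).trans ?_
    nlinarith [mul_nonneg h0 h2, mul_nonneg h0 h3, mul_nonneg h1 h2, mul_nonneg h1 h3]

lemma norm_derivForm_le (a₀ a₁ : ℤ) (n : ℤ × ℤ) :
    ‖derivForm a₀ a₁ n‖ ≤ 4 * Real.pi * (1 + |(a₀ : ℝ)| + |(a₁ : ℝ)|) * latticeSize n := by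
  have hp : ∀ l : Fin 2,
      ‖(ContinuousLinearMap.proj l : (Fin 2 → ℂ) →L[ℂ] ℂ)‖ ≤ 1 := fun l =>
    ContinuousLinearMap.opNorm_le_bound _ zero_le_one fun z => by
      simpa using norm_le_pi_norm z l
  have hs : ∀ l : Fin 2,
      ‖derivCoeff a₀ a₁ n l • (ContinuousLinearMap.proj l : (Fin 2 → ℂ) →L[ℂ] ℂ)‖ ≤
        2 * Real.pi * (1 + |(a₀ : ℝ)| + |(a₁ : ℝ)|) * latticeSize n := fun l => by
    rw [norm_smul]
    exact (mul_le_of_le_one_right (norm_nonneg _) (hp l)).trans (norm_derivCoeff_le a₀ a₁ n l)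
  refine (norm_add_le _ _).trans ((add_le_add (hs 0) (hs 1)).trans_eq ?_)
  ring

lemma hasFDerivAt_thetaTerm (a₀ a₁ b₀ b₁ : ℤ) (τ : Matrix (Fin 2) (Fin 2) ℂ) (n : ℤ × ℤ)
    (z : Fin 2 → ℂ) :
    HasFDerivAt (fun z => thetaTerm a₀ a₁ b₀ b₁ τ z n)
      (thetaTerm a₀ a₁ b₀ b₁ τ z n • derivForm a₀ a₁ n) z := by
  have h0 : HasFDerivAt (fun z : Fin 2 → ℂ => z 0)
      (ContinuousLinearMap.proj 0 : (Fin 2 → ℂ) →L[ℂ] ℂ) z := hasFDerivAt_apply 0 z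
  have h1 : HasFDerivAt (fun z : Fin 2 → ℂ => z 1)
      (ContinuousLinearMap.proj 1 : (Fin 2 → ℂ) →L[ℂ] ℂ) z := hasFDerivAt_apply 1 z
  have h := (((((h0.add_const ((b₀ : ℂ) / 2)).const_mul ((n.1 : ℂ) + a₀ / 2)).add
    ((h1.add_const ((b₁ : ℂ) / 2)).const_mul ((n.2 : ℂ) + a₁ / 2))).const_mul
    (2 * (Real.pi : ℂ) * Complex.I)).const_add
    ((Real.pi : ℂ) * Complex.I * quadForm τ (n.1 + a₀ / 2) (n.2 + a₁ / 2))).cexp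
  refine h.congr_fderiv ?_
  unfold thetaTerm
  congr 1
  ext w
  simp [derivForm, derivCoeff]
  ring

lemma hasFDerivAt_theta {τ : Matrix (Fin 2) (Fin 2) ℂ} (hτ : PosIm τ) (a₀ a₁ b₀ b₁ : ℤ) :
    HasFDerivAt (fun z => theta (halfChar a₀ a₁ b₀ b₁) z τ)
      (∑' n, thetaTerm a₀ a₁ b₀ b₁ τ 0 n • derivForm a₀ a₁ n) 0 := by
  simp only [theta_halfChar]
  obtain ⟨C, hC, h⟩ := exists_bound_thetaTerm hτ a₀ a₁ b₀ b₁ 1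
  set K := 4 * Real.pi * (1 + |(a₀ : ℝ)| + |(a₁ : ℝ)|)
  have hK : 0 ≤ K := by have := Real.pi_pos; positivity
  refine hasFDerivAt_tsum_of_isPreconnected
    (u := fun n => K * (C * Real.exp (-latticeSize n))) (s := Metric.ball 0 1) (x₀ := 0)
    ((summable_exp_neg_latticeSize.mul_left C).mul_left K) Metric.isOpen_ball
    (convex_ball _ _).isPreconnected
    (fun n z _ => hasFDerivAt_thetaTerm a₀ a₁ b₀ b₁ τ n z) (fun n z hz => ?_)
    (Metric.mem_ball_self one_pos) (summable_norm_thetaTerm hτ a₀ a₁ b₀ b₁ 0).of_norm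
    (Metric.mem_ball_self one_pos)
  have hz' : ‖z‖ ≤ 1 := (mem_ball_zero_iff.1 hz).le
  rw [norm_smul]
  calc ‖thetaTerm a₀ a₁ b₀ b₁ τ z n‖ * ‖derivForm a₀ a₁ n‖
      ≤ ‖thetaTerm a₀ a₁ b₀ b₁ τ z n‖ * (K * latticeSize n) :=
        mul_le_mul_of_nonneg_left (norm_derivForm_le a₀ a₁ n) (norm_nonneg _)
    _ = K * (latticeSize n * ‖thetaTerm a₀ a₁ b₀ b₁ τ z n‖) := by ring
    _ ≤ _ := mul_le_mul_of_nonneg_left (h z hz' n) hK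

/-- The theta constant with characteristic `[a/2; b/2]`. -/
def thetaNull (a₀ a₁ b₀ b₁ : ℤ) (τ : Matrix (Fin 2) (Fin 2) ℂ) : ℂ :=
  theta (halfChar a₀ a₁ b₀ b₁) 0 τ

/-- The derivative at `0` in direction `l` of the theta function with characteristic
`[a/2; b/2]`. -/
def thetaDeriv (l : Fin 2) (a₀ a₁ b₀ b₁ : ℤ) (τ : Matrix (Fin 2) (Fin 2) ℂ) : ℂ :=
  fderiv ℂ (fun z : Fin 2 → ℂ => theta (halfChar a₀ a₁ b₀ b₁) z τ) 0 (Pi.single l 1)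

lemma thetaNull_eq_tsum (a₀ a₁ b₀ b₁ : ℤ) (τ : Matrix (Fin 2) (Fin 2) ℂ) :
    thetaNull a₀ a₁ b₀ b₁ τ = ∑' n, thetaTerm a₀ a₁ b₀ b₁ τ 0 n :=
  theta_halfChar a₀ a₁ b₀ b₁ 0 τ

lemma summable_thetaTerm_smul {τ : Matrix (Fin 2) (Fin 2) ℂ} (hτ : PosIm τ)
    (a₀ a₁ b₀ b₁ : ℤ) :
    Summable fun n => thetaTerm a₀ a₁ b₀ b₁ τ 0 n • derivForm a₀ a₁ n := by
  set K := 4 * Real.pi * (1 + |(a₀ : ℝ)| + |(a₁ : ℝ)|)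
  refine Summable.of_norm_bounded
    ((summable_latticeSize_mul_norm hτ a₀ a₁ b₀ b₁ 0).mul_left K) fun n => ?_
  rw [norm_smul]
  calc ‖thetaTerm a₀ a₁ b₀ b₁ τ 0 n‖ * ‖derivForm a₀ a₁ n‖
      ≤ ‖thetaTerm a₀ a₁ b₀ b₁ τ 0 n‖ * (K * latticeSize n) :=
        mul_le_mul_of_nonneg_left (norm_derivForm_le a₀ a₁ n) (norm_nonneg _)
    _ = K * (latticeSize n * ‖thetaTerm a₀ a₁ b₀ b₁ τ 0 n‖) := by ring

lemma thetaDeriv_eq_tsum {τ : Matrix (Fin 2) (Fin 2) ℂ} (hτ : PosIm τ) (l : Fin 2)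
    (a₀ a₁ b₀ b₁ : ℤ) :
    thetaDeriv l a₀ a₁ b₀ b₁ τ =
      ∑' n, derivCoeff a₀ a₁ n l * thetaTerm a₀ a₁ b₀ b₁ τ 0 n := by
  rw [thetaDeriv, (hasFDerivAt_theta hτ a₀ a₁ b₀ b₁).fderiv]
  have h := (ContinuousLinearMap.apply ℂ ℂ (Pi.single l (1 : ℂ) : Fin 2 → ℂ)).map_tsum
    (summable_thetaTerm_smul hτ a₀ a₁ b₀ b₁)
  simp only [ContinuousLinearMap.apply_apply] at h
  rw [h]
  refine tsum_congr fun n => ?_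
  fin_cases l <;> simp [derivForm, mul_comm]

lemma quadForm_smul (c : ℂ) (τ : Matrix (Fin 2) (Fin 2) ℂ) (x y : ℂ) :
    quadForm (c • τ) x y = c * quadForm τ x y := by
  simp only [quadForm, Matrix.smul_apply, smul_eq_mul]
  ring

lemma PosIm.two_smul {τ : Matrix (Fin 2) (Fin 2) ℂ} (hτ : PosIm τ) : PosIm ((2 : ℂ) • τ) := by
  obtain ⟨c, hc, h⟩ := hτ
  refine ⟨c, hc, fun x y => ?_⟩
  have h1 := h x y
  have h2 : (quadForm ((2 : ℂ) • τ) x y).im = 2 * (quadForm τ x y).im := by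
    rw [quadForm_smul]; simp
  nlinarith [sq_nonneg x, sq_nonneg y, mul_nonneg hc.le (add_nonneg (sq_nonneg x) (sq_nonneg y))]

/-- Pairs of integers, parametrised by the parity of their difference, half of their
sum and half of their difference. -/
def parityEquiv : Fin 2 × ℤ × ℤ ≃ ℤ × ℤ where
  toFun x := (x.2.1 + x.2.2 + (x.1 : ℕ), x.2.1 - x.2.2)
  invFun y := (⟨((y.1 - y.2) % 2).toNat, by omega⟩, y.2 + (y.1 - y.2) / 2, (y.1 - y.2) / 2)
  left_inv := by
    rintro ⟨s, p, q⟩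
    have hs := s.2
    simp only [Prod.mk.injEq, Fin.ext_iff]
    omega
  right_inv := by
    rintro ⟨m, n⟩
    simp only [Prod.mk.injEq]
    omega

/-- Pairs of points of `ℤ²`, parametrised by parity of the difference, half of the sum and half of
the difference. -/
def parityEquiv₂ : (Fin 2 × Fin 2) × (ℤ × ℤ) × (ℤ × ℤ) ≃ (ℤ × ℤ) × (ℤ × ℤ) where
  toFun x :=
    let u := parityEquiv (x.1.1, x.2.1.1, x.2.2.1)
    let v := parityEquiv (x.1.2, x.2.1.2, x.2.2.2)
    ((u.1, v.1), (u.2, v.2))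
  invFun y :=
    let u := parityEquiv.symm (y.1.1, y.2.1)
    let v := parityEquiv.symm (y.1.2, y.2.2)
    ((u.1, v.1), (u.2.1, v.2.1), (u.2.2, v.2.2))
  left_inv := by rintro ⟨⟨s, t⟩, ⟨p, p'⟩, ⟨q, q'⟩⟩; simp
  right_inv := by rintro ⟨⟨m, m'⟩, ⟨n, n'⟩⟩; simp

lemma thetaTerm_mul (a₀ a₁ b₀ b₁ b₀' b₁' : ℤ) (τ : Matrix (Fin 2) (Fin 2) ℂ) (z : Fin 2 → ℂ)
    (s : Fin 2 × Fin 2) (p q : ℤ × ℤ) :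
    thetaTerm a₀ a₁ b₀ b₁ τ z (parityEquiv₂ (s, p, q)).1 *
        thetaTerm a₀ a₁ b₀' b₁' τ z (parityEquiv₂ (s, p, q)).2 =
      thetaTerm (a₀ + (s.1 : ℕ)) (a₁ + (s.2 : ℕ)) (b₀ + b₀') (b₁ + b₁') ((2 : ℂ) • τ)
          ((2 : ℂ) • z) p *
        thetaTerm (s.1 : ℕ) (s.2 : ℕ) (b₀ - b₀') (b₁ - b₁') ((2 : ℂ) • τ) 0 q := by
  unfold thetaTerm
  rw [← Complex.exp_add, ← Complex.exp_add]
  congr 1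
  simp only [parityEquiv₂, parityEquiv, Equiv.coe_fn_mk, quadForm, Matrix.smul_apply, smul_eq_mul,
    Pi.smul_apply, Pi.zero_apply]
  push_cast
  ring

/-- The duplication formula for products of theta functions. -/
lemma theta_mul_theta {τ : Matrix (Fin 2) (Fin 2) ℂ} (hτ : PosIm τ)
    (a₀ a₁ b₀ b₁ b₀' b₁' : ℤ) (z : Fin 2 → ℂ) :
    theta (halfChar a₀ a₁ b₀ b₁) z τ * theta (halfChar a₀ a₁ b₀' b₁') z τ =
      ∑ s : Fin 2 × Fin 2,
        theta (halfChar (a₀ + (s.1 : ℕ)) (a₁ + (s.2 : ℕ)) (b₀ + b₀') (b₁ + b₁'))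
            ((2 : ℂ) • z) ((2 : ℂ) • τ) *
          thetaNull (s.1 : ℕ) (s.2 : ℕ) (b₀ - b₀') (b₁ - b₁') ((2 : ℂ) • τ) := by
  have hl₁ := summable_norm_thetaTerm hτ a₀ a₁ b₀ b₁ z
  have hl₂ := summable_norm_thetaTerm hτ a₀ a₁ b₀' b₁' z
  have hs := (hl₁.mul_norm hl₂).of_norm
  rw [← parityEquiv₂.summable_iff] at hs
  simp only [Function.comp_def] at hs
  simp only [theta_halfChar, thetaNull]
  rw [tsum_mul_tsum_of_summable_norm hl₁ hl₂, ← parityEquiv₂.tsum_eq,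
    hs.tsum_prod, tsum_fintype]
  refine Finset.sum_congr rfl fun s _ => ?_
  rw [tsum_mul_tsum_of_summable_norm (summable_norm_thetaTerm hτ.two_smul _ _ _ _ _)
    (summable_norm_thetaTerm hτ.two_smul _ _ _ _ _)]
  exact tsum_congr fun x => thetaTerm_mul a₀ a₁ b₀ b₁ b₀' b₁' τ z s x.1 x.2

lemma thetaNull_mul {τ : Matrix (Fin 2) (Fin 2) ℂ} (hτ : PosIm τ) (a₀ a₁ b₀ b₁ b₀' b₁' : ℤ) :
    thetaNull a₀ a₁ b₀ b₁ τ * thetaNull a₀ a₁ b₀' b₁' τ =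
      thetaNull a₀ a₁ (b₀ + b₀') (b₁ + b₁') ((2 : ℂ) • τ) *
          thetaNull 0 0 (b₀ - b₀') (b₁ - b₁') ((2 : ℂ) • τ) +
        thetaNull a₀ (a₁ + 1) (b₀ + b₀') (b₁ + b₁') ((2 : ℂ) • τ) *
          thetaNull 0 1 (b₀ - b₀') (b₁ - b₁') ((2 : ℂ) • τ) +
        (thetaNull (a₀ + 1) a₁ (b₀ + b₀') (b₁ + b₁') ((2 : ℂ) • τ) *
          thetaNull 1 0 (b₀ - b₀') (b₁ - b₁') ((2 : ℂ) • τ) +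
        thetaNull (a₀ + 1) (a₁ + 1) (b₀ + b₀') (b₁ + b₁') ((2 : ℂ) • τ) *
          thetaNull 1 1 (b₀ - b₀') (b₁ - b₁') ((2 : ℂ) • τ)) := by
  have h := theta_mul_theta hτ a₀ a₁ b₀ b₁ b₀' b₁' 0
  simpa [Fintype.sum_prod_type, Fin.sum_univ_two, thetaNull] using h

lemma thetaDeriv_mul {τ : Matrix (Fin 2) (Fin 2) ℂ} (hτ : PosIm τ) (l : Fin 2)
    (a₀ a₁ b₀ b₁ b₀' b₁' : ℤ) :
    thetaDeriv l a₀ a₁ b₀ b₁ τ * thetaNull a₀ a₁ b₀' b₁' τ +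
        thetaNull a₀ a₁ b₀ b₁ τ * thetaDeriv l a₀ a₁ b₀' b₁' τ =
      2 * (thetaDeriv l a₀ a₁ (b₀ + b₀') (b₁ + b₁') ((2 : ℂ) • τ) *
          thetaNull 0 0 (b₀ - b₀') (b₁ - b₁') ((2 : ℂ) • τ) +
        thetaDeriv l a₀ (a₁ + 1) (b₀ + b₀') (b₁ + b₁') ((2 : ℂ) • τ) *
          thetaNull 0 1 (b₀ - b₀') (b₁ - b₁') ((2 : ℂ) • τ) +
        (thetaDeriv l (a₀ + 1) a₁ (b₀ + b₀') (b₁ + b₁') ((2 : ℂ) • τ) *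
          thetaNull 1 0 (b₀ - b₀') (b₁ - b₁') ((2 : ℂ) • τ) +
        thetaDeriv l (a₀ + 1) (a₁ + 1) (b₀ + b₀') (b₁ + b₁') ((2 : ℂ) • τ) *
          thetaNull 1 1 (b₀ - b₀') (b₁ - b₁') ((2 : ℂ) • τ))) := by
  have hd := fun b₀ b₁ => (hasFDerivAt_theta hτ a₀ a₁ b₀ b₁).differentiableAt.hasFDerivAt
  have h1 := (hd b₀ b₁).mul (hd b₀' b₁')
  have hs : ∀ s : Fin 2 × Fin 2, HasFDerivAt (fun z : Fin 2 → ℂ =>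
      theta (halfChar (a₀ + (s.1 : ℕ)) (a₁ + (s.2 : ℕ)) (b₀ + b₀') (b₁ + b₁'))
            ((2 : ℂ) • z) ((2 : ℂ) • τ) *
          thetaNull (s.1 : ℕ) (s.2 : ℕ) (b₀ - b₀') (b₁ - b₁') ((2 : ℂ) • τ)) _ 0 := fun s =>
    HasFDerivAt.mul_const (HasFDerivAt.comp (g := fun z : Fin 2 → ℂ =>
      theta (halfChar (a₀ + (s.1 : ℕ)) (a₁ + (s.2 : ℕ)) (b₀ + b₀') (b₁ + b₁')) z ((2 : ℂ) • τ))
      (f := fun z : Fin 2 → ℂ => (2 : ℂ) • z) 0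
      (by
        simpa using (hasFDerivAt_theta hτ.two_smul (a₀ + (s.1 : ℕ)) (a₁ + (s.2 : ℕ)) (b₀ + b₀')
          (b₁ + b₁')).differentiableAt.hasFDerivAt)
      ((hasFDerivAt_id (0 : Fin 2 → ℂ)).const_smul (2 : ℂ))) _
  have h2 := HasFDerivAt.fun_sum (u := Finset.univ) fun s _ => hs s
  have h3 := h1.unique (h2.congr_of_eventuallyEq
    (Filter.Eventually.of_forall fun z => theta_mul_theta hτ a₀ a₁ b₀ b₁ b₀' b₁' z))
  have h4 := congrArg (fun φ : (Fin 2 → ℂ) →L[ℂ] ℂ => φ (Pi.single l 1)) h3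
  simp only [Fintype.sum_prod_type, Fin.sum_univ_two] at h4
  simp at h4
  simp only [thetaDeriv]
  simp only [thetaNull] at h4 ⊢
  linear_combination h4

lemma thetaTerm_add_two_left (a₀ a₁ b₀ b₁ k₀ k₁ : ℤ) (τ : Matrix (Fin 2) (Fin 2) ℂ)
    (z : Fin 2 → ℂ) (n : ℤ × ℤ) :
    thetaTerm (a₀ + 2 * k₀) (a₁ + 2 * k₁) b₀ b₁ τ z n =
      thetaTerm a₀ a₁ b₀ b₁ τ z (n.1 + k₀, n.2 + k₁) := by
  unfold thetaTerm quadForm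
  congr 1
  push_cast
  ring

lemma theta_add_two_left (a₀ a₁ b₀ b₁ k₀ k₁ : ℤ) (z : Fin 2 → ℂ)
    (τ : Matrix (Fin 2) (Fin 2) ℂ) :
    theta (halfChar (a₀ + 2 * k₀) (a₁ + 2 * k₁) b₀ b₁) z τ = theta (halfChar a₀ a₁ b₀ b₁) z τ := by
  rw [theta_halfChar, theta_halfChar,
    ← ((Equiv.addRight k₀).prodCongr (Equiv.addRight k₁)).tsum_eq (thetaTerm a₀ a₁ b₀ b₁ τ z)]
  exact tsum_congr fun n => thetaTerm_add_two_left a₀ a₁ b₀ b₁ k₀ k₁ τ z n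

lemma exp_pi_mul_I_mul_int (m : ℤ) :
    Complex.exp ((Real.pi : ℂ) * Complex.I * m) = (-1) ^ m := by
  rw [← Complex.exp_pi_mul_I, ← Complex.exp_int_mul]
  congr 1
  ring

lemma exp_two_pi_mul_I_mul_int (m : ℤ) :
    Complex.exp (2 * (Real.pi : ℂ) * Complex.I * m) = 1 := by
  rw [← Complex.exp_int_mul_two_pi_mul_I m]
  congr 1
  ring

lemma theta_add_two_right (a₀ a₁ b₀ b₁ k₀ k₁ : ℤ) (z : Fin 2 → ℂ)
    (τ : Matrix (Fin 2) (Fin 2) ℂ) :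
    theta (halfChar a₀ a₁ (b₀ + 2 * k₀) (b₁ + 2 * k₁)) z τ =
      (-1) ^ (a₀ * k₀ + a₁ * k₁) * theta (halfChar a₀ a₁ b₀ b₁) z τ := by
  rw [theta_halfChar, theta_halfChar, ← tsum_mul_left]
  refine tsum_congr fun n => ?_
  rw [← exp_pi_mul_I_mul_int, ← one_mul (Complex.exp _ * _),
    ← exp_two_pi_mul_I_mul_int (n.1 * k₀ + n.2 * k₁), thetaTerm, thetaTerm, ← Complex.exp_add,
    ← Complex.exp_add]
  congr 1
  push_cast
  ring

lemma theta_neg (a₀ a₁ b₀ b₁ : ℤ) (z : Fin 2 → ℂ) (τ : Matrix (Fin 2) (Fin 2) ℂ) :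
    theta (halfChar a₀ a₁ b₀ b₁) (-z) τ =
      (-1) ^ (a₀ * b₀ + a₁ * b₁) * theta (halfChar a₀ a₁ b₀ b₁) z τ := by
  rw [theta_halfChar, theta_halfChar, ← tsum_mul_left,
    ← ((Equiv.subLeft (-a₀)).prodCongr (Equiv.subLeft (-a₁))).tsum_eq]
  refine tsum_congr fun n => ?_
  rw [← exp_pi_mul_I_mul_int, ← one_mul (thetaTerm a₀ a₁ b₀ b₁ τ (-z) _),
    ← exp_two_pi_mul_I_mul_int (n.1 * b₀ + n.2 * b₁ + a₀ * b₀ + a₁ * b₁),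
    thetaTerm, thetaTerm, ← Complex.exp_add, ← Complex.exp_add]
  congr 1
  simp only [quadForm, Equiv.prodCongr_apply, Prod.map, Equiv.subLeft_apply, Pi.neg_apply]
  push_cast
  ring

lemma thetaNull_eq_zero {a₀ a₁ b₀ b₁ : ℤ} (h : Odd (a₀ * b₀ + a₁ * b₁))
    (τ : Matrix (Fin 2) (Fin 2) ℂ) : thetaNull a₀ a₁ b₀ b₁ τ = 0 := by
  have := theta_neg a₀ a₁ b₀ b₁ 0 τ
  rw [neg_zero, h.neg_one_zpow] at this
  unfold thetaNull
  linear_combination this / 2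

lemma thetaDeriv_eq_zero {τ : Matrix (Fin 2) (Fin 2) ℂ} (hτ : PosIm τ) {a₀ a₁ b₀ b₁ : ℤ}
    (h : Even (a₀ * b₀ + a₁ * b₁)) (l : Fin 2) : thetaDeriv l a₀ a₁ b₀ b₁ τ = 0 := by
  have h1 : (fun z : Fin 2 → ℂ => theta (halfChar a₀ a₁ b₀ b₁) (-z) τ) =
      fun z => theta (halfChar a₀ a₁ b₀ b₁) z τ := by
    funext z
    rw [theta_neg, h.neg_one_zpow, one_mul]
  have hd := (hasFDerivAt_theta hτ a₀ a₁ b₀ b₁).differentiableAt.hasFDerivAt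
  have h2 := HasFDerivAt.comp (g := fun z : Fin 2 → ℂ => theta (halfChar a₀ a₁ b₀ b₁) z τ)
    (f := fun z : Fin 2 → ℂ => -z) 0 (by simpa using hd) (hasFDerivAt_id (0 : Fin 2 → ℂ)).neg
  have h3 := congrArg (fun φ : (Fin 2 → ℂ) →L[ℂ] ℂ => φ (Pi.single l 1))
    (hd.unique (h2.congr_of_eventuallyEq (Filter.Eventually.of_forall fun z => by
      simpa using (congrFun h1 z).symm)))
  simp at h3
  unfold thetaDeriv
  linear_combination h3 / 2

/-- The points of `ℤ²` at which `n + a/2` is of minimal length for the `A₂` form,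
when `a ∈ {0, 1}²`. -/
def leadSet (a₀ a₁ : ℤ) : Finset (ℤ × ℤ) := {(0, -(a₀ * a₁)), (-a₀, a₀ * a₁ - a₁)}

/-- The exponential common to the leading terms of the theta series. -/
def leadExp (a₀ a₁ : ℤ) (τ : Matrix (Fin 2) (Fin 2) ℂ) : ℂ :=
  Complex.exp ((Real.pi : ℂ) * Complex.I * quadForm τ (a₀ / 2) (a₁ / 2 - a₀ * a₁))

/-- The root of unity multiplying the exponential in the general term of a theta constant. -/
def thetaPhase (a₀ a₁ b₀ b₁ : ℤ) (n : ℤ × ℤ) : ℂ :=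
  Complex.exp ((Real.pi : ℂ) * Complex.I * ((n.1 + a₀ / 2) * b₀ + (n.2 + a₁ / 2) * b₁))

/-- The leading terms of all theta series dominate the others, by a margin measured by `r`. -/
structure LeadDominant (r : ℝ) (τ : Matrix (Fin 2) (Fin 2) ℂ) : Prop where
  posIm : PosIm τ
  gap : ∀ a₀ a₁ : ℤ, (a₀ = 0 ∨ a₀ = 1) → (a₁ = 0 ∨ a₁ = 1) → ∀ n ∉ leadSet a₀ a₁,
    (r + 2) * latticeSize n ≤
      Real.pi * ((quadForm τ ((n.1 + a₀ / 2 : ℝ) : ℂ) ((n.2 + a₁ / 2 : ℝ) : ℂ)).im -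
        (quadForm τ ((a₀ / 2 : ℝ) : ℂ) ((a₁ / 2 - a₀ * a₁ : ℝ) : ℂ)).im)

lemma LeadDominant.two_smul {r : ℝ} {τ : Matrix (Fin 2) (Fin 2) ℂ} (h : LeadDominant r τ) :
    LeadDominant (2 * r) ((2 : ℂ) • τ) := by
  refine ⟨h.posIm.two_smul, fun a₀ a₁ h₀ h₁ n hn => ?_⟩
  have h2 : ∀ x y : ℂ, (quadForm ((2 : ℂ) • τ) x y).im = 2 * (quadForm τ x y).im := fun x y => by
    rw [quadForm_smul]; simp
  rw [h2, h2]
  have := h.gap a₀ a₁ h₀ h₁ n hn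
  have := one_le_latticeSize n
  linarith

lemma LeadDominant.pow_smul {r : ℝ} {τ : Matrix (Fin 2) (Fin 2) ℂ} (h : LeadDominant r τ)
    (N : ℕ) : LeadDominant (2 ^ N * r) ((2 : ℂ) ^ N • τ) := by
  induction N with
  | zero => simpa using h
  | succ N ih =>
    rw [pow_succ', pow_succ', mul_assoc, mul_smul]
    exact ih.two_smul

lemma LeadDominant.mono {r s : ℝ} {τ : Matrix (Fin 2) (Fin 2) ℂ} (h : LeadDominant r τ)
    (hs : s ≤ r) : LeadDominant s τ := by
  refine ⟨h.posIm, fun a₀ a₁ h₀ h₁ n hn => le_trans ?_ (h.gap a₀ a₁ h₀ h₁ n hn)⟩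
  have := one_le_latticeSize n
  gcongr

lemma norm_leadExp (a₀ a₁ : ℤ) (τ : Matrix (Fin 2) (Fin 2) ℂ) :
    ‖leadExp a₀ a₁ τ‖ = Real.exp (-Real.pi *
      (quadForm τ ((a₀ / 2 : ℝ) : ℂ) ((a₁ / 2 - a₀ * a₁ : ℝ) : ℂ)).im) := by
  rw [leadExp, Complex.norm_exp]
  push_cast
  simp

/-- The total mass of the majorant. -/
def majorantSum : ℝ := ∑' n : ℤ × ℤ, Real.exp (-latticeSize n)

lemma norm_tsum_sub_sum_leadSet_le {r : ℝ} {τ : Matrix (Fin 2) (Fin 2) ℂ}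
    (h : LeadDominant r τ) (hr : 0 ≤ r) {a₀ a₁ b₀ b₁ : ℤ} (h₀ : a₀ = 0 ∨ a₀ = 1)
    (h₁ : a₁ = 0 ∨ a₁ = 1) {f : ℤ × ℤ → ℂ} {C : ℝ} (hC : 0 ≤ C)
    (hf : ∀ n, ‖f n‖ ≤ C * (latticeSize n * ‖thetaTerm a₀ a₁ b₀ b₁ τ 0 n‖)) :
    ‖∑' n, f n - ∑ n ∈ leadSet a₀ a₁, f n‖ ≤
      C * Real.exp (-r) * ‖leadExp a₀ a₁ τ‖ * majorantSum := by
  have hsum : Summable f := Summable.of_norm_bounded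
    ((summable_latticeSize_mul_norm h.posIm a₀ a₁ b₀ b₁ 0).mul_left C) hf
  rw [← hsum.sum_add_tsum_compl (s := leadSet a₀ a₁), add_sub_cancel_left,
    tsum_subtype ((leadSet a₀ a₁ : Set (ℤ × ℤ))ᶜ) f]
  refine tsum_of_norm_bounded (summable_exp_neg_latticeSize.hasSum.mul_left _) fun n => ?_
  by_cases hn : n ∈ leadSet a₀ a₁
  · rw [Set.indicator_of_notMem (by simpa using hn), norm_zero]
    positivity
  · rw [Set.indicator_of_mem (by simpa using hn)]
    refine (hf n).trans ?_
    rw [mul_assoc, mul_assoc]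
    refine mul_le_mul_of_nonneg_left ?_ hC
    have hL : latticeSize n ≤ Real.exp (latticeSize n) := by
      linarith [Real.add_one_le_exp (latticeSize n)]
    refine (mul_le_mul_of_nonneg_right hL (norm_nonneg _)).trans ?_
    rw [norm_thetaTerm, norm_leadExp, ← Real.exp_add, ← Real.exp_add, ← Real.exp_add]
    apply Real.exp_le_exp.2
    have h2 := h.gap a₀ a₁ h₀ h₁ n hn
    have h3 := one_le_latticeSize n
    simp only [Pi.zero_apply, Complex.zero_im, mul_zero, add_zero, sub_zero]
    nlinarith [mul_le_mul_of_nonneg_left h3 hr]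

lemma thetaTerm_of_mem_leadSet {a₀ a₁ : ℤ} (b₀ b₁ : ℤ) (τ : Matrix (Fin 2) (Fin 2) ℂ)
    {n : ℤ × ℤ} (hn : n ∈ leadSet a₀ a₁) :
    thetaTerm a₀ a₁ b₀ b₁ τ 0 n = leadExp a₀ a₁ τ * thetaPhase a₀ a₁ b₀ b₁ n := by
  rw [thetaTerm, leadExp, thetaPhase, ← Complex.exp_add]
  congr 1
  simp only [leadSet, Finset.mem_insert, Finset.mem_singleton] at hn
  rcases hn with rfl | rfl <;>
  · simp only [quadForm, Pi.zero_apply]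
    push_cast
    ring

/-- The leading coefficient of a theta constant. -/
def leadNull (a₀ a₁ b₀ b₁ : ℤ) : ℂ := ∑ n ∈ leadSet a₀ a₁, thetaPhase a₀ a₁ b₀ b₁ n

/-- The leading coefficient of a derivative of a theta function at the origin. -/
def leadDeriv (l : Fin 2) (a₀ a₁ b₀ b₁ : ℤ) : ℂ :=
  ∑ n ∈ leadSet a₀ a₁, derivCoeff a₀ a₁ n l * thetaPhase a₀ a₁ b₀ b₁ n

lemma leadExp_ne_zero (a₀ a₁ : ℤ) (τ : Matrix (Fin 2) (Fin 2) ℂ) : leadExp a₀ a₁ τ ≠ 0 :=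
  Complex.exp_ne_zero _

lemma norm_thetaNull_div_sub_le {r : ℝ} {τ : Matrix (Fin 2) (Fin 2) ℂ}
    (h : LeadDominant r τ) (hr : 0 ≤ r) {a₀ a₁ : ℤ} (b₀ b₁ : ℤ) (h₀ : a₀ = 0 ∨ a₀ = 1)
    (h₁ : a₁ = 0 ∨ a₁ = 1) :
    ‖thetaNull a₀ a₁ b₀ b₁ τ / leadExp a₀ a₁ τ - leadNull a₀ a₁ b₀ b₁‖ ≤
      Real.exp (-r) * majorantSum := by
  have key := norm_tsum_sub_sum_leadSet_le h hr h₀ h₁ (b₀ := b₀) (b₁ := b₁)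
    (f := thetaTerm a₀ a₁ b₀ b₁ τ 0) zero_le_one
    (fun n => by
      rw [one_mul]
      exact le_mul_of_one_le_left (norm_nonneg _) (one_le_latticeSize n))
  rw [Finset.sum_congr rfl fun n hn => thetaTerm_of_mem_leadSet b₀ b₁ τ hn, ← Finset.mul_sum,
    ← thetaNull_eq_tsum] at key
  have hE := norm_pos_iff.2 (leadExp_ne_zero a₀ a₁ τ)
  rw [leadNull, div_sub' (leadExp_ne_zero a₀ a₁ τ), norm_div, div_le_iff₀ hE]
  exact key.trans_eq (by ring)

lemma norm_thetaDeriv_div_sub_le {r : ℝ} {τ : Matrix (Fin 2) (Fin 2) ℂ}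
    (h : LeadDominant r τ) (hr : 0 ≤ r) (l : Fin 2) {a₀ a₁ : ℤ} (b₀ b₁ : ℤ)
    (h₀ : a₀ = 0 ∨ a₀ = 1) (h₁ : a₁ = 0 ∨ a₁ = 1) :
    ‖thetaDeriv l a₀ a₁ b₀ b₁ τ / leadExp a₀ a₁ τ - leadDeriv l a₀ a₁ b₀ b₁‖ ≤
      2 * Real.pi * (1 + |(a₀ : ℝ)| + |(a₁ : ℝ)|) * majorantSum * Real.exp (-r) := by
  have key := norm_tsum_sub_sum_leadSet_le h hr h₀ h₁ (b₀ := b₀) (b₁ := b₁)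
    (f := fun n => derivCoeff a₀ a₁ n l * thetaTerm a₀ a₁ b₀ b₁ τ 0 n)
    (C := 2 * Real.pi * (1 + |(a₀ : ℝ)| + |(a₁ : ℝ)|))
    (by have := Real.pi_pos; positivity)
    (fun n => by
      rw [norm_mul, ← mul_assoc]
      exact mul_le_mul_of_nonneg_right (norm_derivCoeff_le a₀ a₁ n l) (norm_nonneg _))
  rw [Finset.sum_congr rfl fun n hn => by
      rw [thetaTerm_of_mem_leadSet b₀ b₁ τ hn, mul_left_comm], ← Finset.mul_sum,
    ← thetaDeriv_eq_tsum h.posIm] at key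
  have hE := norm_pos_iff.2 (leadExp_ne_zero a₀ a₁ τ)
  rw [leadDeriv, div_sub' (leadExp_ne_zero a₀ a₁ τ), norm_div, div_le_iff₀ hE]
  exact key.trans_eq (by ring)

lemma tendsto_exp_neg_two_pow_mul {r : ℝ} (hr : 0 < r) :
    Filter.Tendsto (fun N : ℕ => Real.exp (-(2 ^ N * r))) Filter.atTop (nhds 0) := by
  refine Real.tendsto_exp_neg_atTop_nhds_zero.comp ?_
  exact (tendsto_pow_atTop_atTop_of_one_lt one_lt_two).atTop_mul_const hr

lemma tendsto_thetaNull_div {r : ℝ} {τ : Matrix (Fin 2) (Fin 2) ℂ} (h : LeadDominant r τ)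
    (hr : 0 < r) {a₀ a₁ : ℤ} (b₀ b₁ : ℤ) (h₀ : a₀ = 0 ∨ a₀ = 1) (h₁ : a₁ = 0 ∨ a₁ = 1) :
    Filter.Tendsto (fun N : ℕ => thetaNull a₀ a₁ b₀ b₁ ((2 : ℂ) ^ N • τ) /
      leadExp a₀ a₁ ((2 : ℂ) ^ N • τ)) Filter.atTop (nhds (leadNull a₀ a₁ b₀ b₁)) := by
  refine tendsto_iff_norm_sub_tendsto_zero.2 (squeeze_zero (fun _ => norm_nonneg _)
    (fun N => norm_thetaNull_div_sub_le (h.pow_smul N) (by positivity) b₀ b₁ h₀ h₁) ?_)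
  simpa using (tendsto_exp_neg_two_pow_mul hr).mul_const majorantSum

lemma tendsto_thetaDeriv_div {r : ℝ} {τ : Matrix (Fin 2) (Fin 2) ℂ} (h : LeadDominant r τ)
    (hr : 0 < r) (l : Fin 2) {a₀ a₁ : ℤ} (b₀ b₁ : ℤ) (h₀ : a₀ = 0 ∨ a₀ = 1)
    (h₁ : a₁ = 0 ∨ a₁ = 1) :
    Filter.Tendsto (fun N : ℕ => thetaDeriv l a₀ a₁ b₀ b₁ ((2 : ℂ) ^ N • τ) /
      leadExp a₀ a₁ ((2 : ℂ) ^ N • τ)) Filter.atTop (nhds (leadDeriv l a₀ a₁ b₀ b₁)) := by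
  refine tendsto_iff_norm_sub_tendsto_zero.2 (squeeze_zero (fun _ => norm_nonneg _)
    (fun N => norm_thetaDeriv_div_sub_le (h.pow_smul N) (by positivity) l b₀ b₁ h₀ h₁) ?_)
  simpa using (tendsto_exp_neg_two_pow_mul hr).const_mul
    (2 * Real.pi * (1 + |(a₀ : ℝ)| + |(a₁ : ℝ)|) * majorantSum)

lemma thetaPhase_eq_I {a₀ a₁ b₀ b₁ : ℤ} {n : ℤ × ℤ}
    (h : ((n.1 : ℂ) + a₀ / 2) * b₀ + (n.2 + a₁ / 2) * b₁ = 1 / 2) :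
    thetaPhase a₀ a₁ b₀ b₁ n = Complex.I := by
  rw [thetaPhase, h, mul_one_div, mul_div_right_comm, Complex.exp_pi_div_two_mul_I]

lemma thetaPhase_eq_neg_I {a₀ a₁ b₀ b₁ : ℤ} {n : ℤ × ℤ}
    (h : ((n.1 : ℂ) + a₀ / 2) * b₀ + (n.2 + a₁ / 2) * b₁ = -(1 / 2)) :
    thetaPhase a₀ a₁ b₀ b₁ n = -Complex.I := by
  rw [thetaPhase, h, mul_neg, Complex.exp_neg, mul_one_div, mul_div_right_comm,
    Complex.exp_pi_div_two_mul_I, Complex.inv_I]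

lemma leadNull_zero_zero (b₀ b₁ : ℤ) : leadNull 0 0 b₀ b₁ = 1 := by
  simp [leadNull, leadSet, thetaPhase]

lemma leadNull_one_zero (b₁ : ℤ) : leadNull 1 0 0 b₁ = 2 := by
  rw [leadNull, leadSet, Finset.sum_pair (by decide)]
  norm_num [thetaPhase]

lemma leadNull_zero_one (b₀ : ℤ) : leadNull 0 1 b₀ 0 = 2 := by
  rw [leadNull, leadSet, Finset.sum_pair (by decide)]
  norm_num [thetaPhase]

lemma leadNull_one_one (b : ℤ) : leadNull 1 1 b b = 2 := by
  rw [leadNull, leadSet, Finset.sum_pair (by decide)]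
  norm_num [thetaPhase]

lemma leadDeriv_one_zero (l : Fin 2) (b₁ : ℤ) :
    leadDeriv l 1 0 1 b₁ = (![-2 * (Real.pi : ℂ), 0] : Fin 2 → ℂ) l := by
  rw [leadDeriv, leadSet, Finset.sum_pair (by decide), thetaPhase_eq_I (by norm_num),
    thetaPhase_eq_neg_I (by norm_num)]
  fin_cases l <;> norm_num [derivCoeff]
  · linear_combination (2 * (Real.pi : ℂ)) * Complex.I_sq

lemma leadDeriv_zero_one (l : Fin 2) (b₀ : ℤ) :
    leadDeriv l 0 1 b₀ 1 = (![0, -2 * (Real.pi : ℂ)] : Fin 2 → ℂ) l := by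
  rw [leadDeriv, leadSet, Finset.sum_pair (by decide), thetaPhase_eq_I (by norm_num),
    thetaPhase_eq_neg_I (by norm_num)]
  fin_cases l <;> norm_num [derivCoeff]
  · linear_combination (2 * (Real.pi : ℂ)) * Complex.I_sq

lemma leadDeriv_one_one_one_zero (l : Fin 2) :
    leadDeriv l 1 1 1 0 = (![-2 * (Real.pi : ℂ), 2 * (Real.pi : ℂ)] : Fin 2 → ℂ) l := by
  rw [leadDeriv, leadSet, Finset.sum_pair (by decide), thetaPhase_eq_I (by norm_num),
    thetaPhase_eq_neg_I (by norm_num)]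
  fin_cases l <;> norm_num [derivCoeff]
  · linear_combination (2 * (Real.pi : ℂ)) * Complex.I_sq
  · linear_combination -(2 * (Real.pi : ℂ)) * Complex.I_sq

lemma leadDeriv_one_one_zero_one (l : Fin 2) :
    leadDeriv l 1 1 0 1 = (![2 * (Real.pi : ℂ), -2 * (Real.pi : ℂ)] : Fin 2 → ℂ) l := by
  rw [leadDeriv, leadSet, Finset.sum_pair (by decide), thetaPhase_eq_neg_I (by norm_num),
    thetaPhase_eq_I (by norm_num)]
  fin_cases l <;> norm_num [derivCoeff]
  · linear_combination -(2 * (Real.pi : ℂ)) * Complex.I_sq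
  · linear_combination (2 * (Real.pi : ℂ)) * Complex.I_sq

lemma exists_leadDominant_thetaNull_ne_zero : ∃ R : ℝ, 0 < R ∧
    ∀ τ, LeadDominant R τ → ∀ a₀ a₁ b₀ b₁ : ℤ, (a₀ = 0 ∨ a₀ = 1) → (a₁ = 0 ∨ a₁ = 1) →
      1 ≤ ‖leadNull a₀ a₁ b₀ b₁‖ → thetaNull a₀ a₁ b₀ b₁ τ ≠ 0 := by
  have hM : Filter.Tendsto (fun r : ℝ => Real.exp (-r) * majorantSum) Filter.atTop (nhds 0) := by
    simpa using Real.tendsto_exp_neg_atTop_nhds_zero.mul_const majorantSum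
  obtain ⟨R, hR, hR0⟩ :=
    ((hM.eventually (gt_mem_nhds one_pos)).and (Filter.eventually_gt_atTop 0)).exists
  refine ⟨R, hR0, fun τ h a₀ a₁ b₀ b₁ h₀ h₁ hl h0 => ?_⟩
  have := norm_thetaNull_div_sub_le h hR0.le b₀ b₁ h₀ h₁
  rw [h0, zero_div, zero_sub, norm_neg] at this
  linarith

/-- The Gram matrix of the `A₂` lattice. -/
def gramA₂ : Matrix (Fin 2) (Fin 2) ℂ := !![2, 1; 1, 2]

/-- The complex ray through `τ` in the direction of `gramA₂`. -/
def siegelRay (τ : Matrix (Fin 2) (Fin 2) ℂ) (s : ℂ) : Matrix (Fin 2) (Fin 2) ℂ :=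
  τ + (s * Complex.I) • gramA₂

lemma siegelRay_zero (τ : Matrix (Fin 2) (Fin 2) ℂ) : siegelRay τ 0 = τ := by
  simp [siegelRay]

lemma quadForm_siegelRay (τ : Matrix (Fin 2) (Fin 2) ℂ) (s x y : ℂ) :
    quadForm (siegelRay τ s) x y =
      quadForm τ x y + s * Complex.I * (2 * (x ^ 2 + x * y + y ^ 2)) := by
  simp only [quadForm, siegelRay, gramA₂, Matrix.add_apply, Matrix.smul_apply, smul_eq_mul,
    Matrix.of_apply, Matrix.cons_val_zero, Matrix.cons_val_one, Matrix.cons_val',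
    Matrix.cons_val_fin_one]
  ring

lemma im_quadForm_siegelRay (τ : Matrix (Fin 2) (Fin 2) ℂ) (s : ℂ) (x y : ℝ) :
    (quadForm (siegelRay τ s) x y).im =
      (quadForm τ x y).im + s.re * (2 * (x ^ 2 + x * y + y ^ 2)) := by
  have h : (2 * ((x : ℂ) ^ 2 + x * y + y ^ 2)) = ((2 * (x ^ 2 + x * y + y ^ 2) : ℝ) : ℂ) := by
    push_cast; rfl
  rw [quadForm_siegelRay, h, Complex.add_im, Complex.im_mul_ofReal, Complex.mul_I_im]

lemma three_le_hexForm {a₀ a₁ : ℤ} (h₀ : a₀ = 0 ∨ a₀ = 1) (h₁ : a₁ = 0 ∨ a₁ = 1) {m n : ℤ}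
    (h : (m, n) ∉ leadSet a₀ a₁) :
    3 ≤ (2 * m + a₀) ^ 2 + (2 * m + a₀) * (2 * n + a₁) + (2 * n + a₁) ^ 2 := by
  by_contra! hlt
  have hm : 3 * (2 * m + a₀) ^ 2 < 12 := by
    nlinarith [sq_nonneg ((2 * m + a₀) + 2 * (2 * n + a₁))]
  have hn : 3 * (2 * n + a₁) ^ 2 < 12 := by
    nlinarith [sq_nonneg (2 * (2 * m + a₀) + (2 * n + a₁))]
  have hm1 : m ≤ 1 := by rcases h₀ with rfl | rfl <;> nlinarith
  have hm2 : -2 ≤ m := by rcases h₀ with rfl | rfl <;> nlinarith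
  have hn1 : n ≤ 1 := by rcases h₁ with rfl | rfl <;> nlinarith
  have hn2 : -2 ≤ n := by rcases h₁ with rfl | rfl <;> nlinarith
  rcases h₀ with rfl | rfl <;> rcases h₁ with rfl | rfl <;> interval_cases m <;>
    interval_cases n <;> first | omega | exact h (by decide)

lemma latticeSize_le_hexForm {a₀ a₁ : ℤ} (h₀ : a₀ = 0 ∨ a₀ = 1) (h₁ : a₁ = 0 ∨ a₁ = 1)
    {n : ℤ × ℤ} (h : n ∉ leadSet a₀ a₁) :
    latticeSize n ≤ 5 * (2 * (((n.1 : ℝ) + a₀ / 2) ^ 2 + ((n.1 : ℝ) + a₀ / 2) * (n.2 + a₁ / 2) +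
        (n.2 + a₁ / 2) ^ 2) -
      2 * (((a₀ : ℝ) / 2) ^ 2 + (a₀ / 2) * (a₁ / 2 - a₀ * a₁) + ((a₁ : ℝ) / 2 - a₀ * a₁) ^ 2)) := by
  obtain ⟨m, n⟩ := n
  have h3 := three_le_hexForm h₀ h₁ h
  have h3' : (3 : ℝ) ≤ (2 * m + a₀) ^ 2 + (2 * m + a₀) * (2 * n + a₁) + (2 * n + a₁) ^ 2 := by
    exact_mod_cast h3
  have ha : ∀ k : ℤ, |(k : ℝ)| ≤ (k : ℝ) ^ 2 := fun k => by
    rw [← sq_abs]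
    have : |k| ≤ |k| ^ 2 := Int.le_self_sq _
    exact_mod_cast this
  have hb : ∀ k a : ℤ, (a = 0 ∨ a = 1) → |(k : ℝ)| ≤ ((2 * k + a : ℤ) : ℝ) ^ 2 / 2 + 1 / 2 := by
    intro k a hka
    have h1 := ha (2 * k + a)
    have h2 : 2 * |(k : ℝ)| ≤ |((2 * k + a : ℤ) : ℝ)| + 1 := by
      have : 2 * |k| ≤ |2 * k + a| + 1 := by
        rcases abs_cases k with h | h <;> rcases abs_cases (2 * k + a) with h' | h' <;> omega
      exact_mod_cast this
    linarith
  have hm := hb m a₀ h₀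
  have hn := hb n a₁ h₁
  push_cast at hm hn
  have hv : ((a₀ : ℝ) / 2) ^ 2 + (a₀ / 2) * (a₁ / 2 - a₀ * a₁) + ((a₁ : ℝ) / 2 - a₀ * a₁) ^ 2 ≤
      1 / 4 := by
    rcases h₀ with rfl | rfl <;> rcases h₁ with rfl | rfl <;> norm_num
  simp only [latticeSize]
  nlinarith [sq_nonneg ((2 * m + a₀ : ℝ) + (2 * n + a₁))]

lemma PosIm.im_quadForm_nonneg {τ : Matrix (Fin 2) (Fin 2) ℂ} (hτ : PosIm τ) (x y : ℝ) :
    0 ≤ (quadForm τ x y).im := by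
  obtain ⟨c, hc, h⟩ := hτ
  exact le_trans (by positivity) (h x y)

/-- The ray through `τ` stays in the Siegel half-space slightly beyond `τ`. -/
lemma PosIm.exists_siegelRay {τ : Matrix (Fin 2) (Fin 2) ℂ} (hτ : PosIm τ) :
    ∃ δ : ℝ, 0 < δ ∧ ∀ s : ℂ, -δ ≤ s.re → PosIm (siegelRay τ s) := by
  obtain ⟨c, hc, h⟩ := hτ
  refine ⟨c / 6, by positivity, fun s hs => ⟨c / 2, by positivity, fun x y => ?_⟩⟩
  rw [im_quadForm_siegelRay]
  have h1 := h x y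
  have h2 : 0 ≤ 2 * (x ^ 2 + x * y + y ^ 2) := by nlinarith [sq_nonneg (x + y)]
  have h3 := mul_le_mul_of_nonneg_right hs h2
  nlinarith [sq_nonneg (x - y), mul_nonneg hc.le (sq_nonneg (x - y))]

lemma PosIm.exists_leadDominant {τ : Matrix (Fin 2) (Fin 2) ℂ} (hτ : PosIm τ) {R : ℝ}
    (hR : 0 < R) : ∃ s₀ : ℝ, 0 < s₀ ∧ ∀ s : ℂ, s₀ ≤ s.re → LeadDominant R (siegelRay τ s) := by
  set q : ℤ → ℤ → ℝ := fun a₀ a₁ =>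
    (quadForm τ ((a₀ / 2 : ℝ) : ℂ) ((a₁ / 2 - a₀ * a₁ : ℝ) : ℂ)).im with hq
  have hq0 : ∀ a₀ a₁, 0 ≤ q a₀ a₁ := fun a₀ a₁ => hτ.im_quadForm_nonneg _ _
  set K := q 0 0 + q 0 1 + q 1 0 + q 1 1 with hK
  have hqK : ∀ a₀ a₁ : ℤ, (a₀ = 0 ∨ a₀ = 1) → (a₁ = 0 ∨ a₁ = 1) → q a₀ a₁ ≤ K := by
    intro a₀ a₁ h₀ h₁
    have h00 := hq0 0 0
    have h01 := hq0 0 1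
    have h10 := hq0 1 0
    have h11 := hq0 1 1
    rcases h₀ with rfl | rfl <;> rcases h₁ with rfl | rfl <;> linarith
  have hK0 : 0 ≤ K := (hq0 0 0).trans (hqK 0 0 (.inl rfl) (.inl rfl))
  have hpi := Real.pi_pos
  refine ⟨5 * (K + (R + 2) / Real.pi), by positivity, fun s hs => ⟨?_, ?_⟩⟩
  · obtain ⟨δ, hδ, h⟩ := hτ.exists_siegelRay
    refine h s (le_trans ?_ hs)
    have : 0 ≤ 5 * (K + (R + 2) / Real.pi) := by positivity
    linarith
  · intro a₀ a₁ h₀ h₁ n hn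
    rw [im_quadForm_siegelRay, im_quadForm_siegelRay]
    have h1 := latticeSize_le_hexForm h₀ h₁ hn
    have h2 := hqK a₀ a₁ h₀ h₁
    have h3 := hτ.im_quadForm_nonneg (n.1 + a₀ / 2) (n.2 + a₁ / 2)
    have h4 := one_le_latticeSize n
    simp only [hq] at h2
    set L := latticeSize n
    set u := 2 * (((n.1 : ℝ) + a₀ / 2) ^ 2 + ((n.1 : ℝ) + a₀ / 2) * (n.2 + a₁ / 2) +
        (n.2 + a₁ / 2) ^ 2)
    set v := 2 * (((a₀ : ℝ) / 2) ^ 2 + (a₀ / 2) * (a₁ / 2 - a₀ * a₁) +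
      ((a₁ : ℝ) / 2 - a₀ * a₁) ^ 2)
    have h5 : (K + (R + 2) / Real.pi) * L ≤ s.re * (u - v) := by
      have h6 : 0 ≤ u - v := by linarith
      have h7 : 0 ≤ K + (R + 2) / Real.pi := by positivity
      nlinarith [mul_le_mul_of_nonneg_right hs h6, mul_le_mul_of_nonneg_left h1 h7]
    have h8 : (R + 2) * L = Real.pi * ((R + 2) / Real.pi * L) := by
      field_simp
    rw [h8]
    refine mul_le_mul_of_nonneg_left ?_ hpi.le
    nlinarith [mul_le_mul_of_nonneg_left h4 hK0]

lemma norm_thetaTerm_siegelRay_le (τ : Matrix (Fin 2) (Fin 2) ℂ) (a₀ a₁ b₀ b₁ : ℤ)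
    {s t : ℂ} (h : t.re ≤ s.re) (n : ℤ × ℤ) :
    ‖thetaTerm a₀ a₁ b₀ b₁ (siegelRay τ s) 0 n‖ ≤
      ‖thetaTerm a₀ a₁ b₀ b₁ (siegelRay τ t) 0 n‖ := by
  rw [norm_thetaTerm, norm_thetaTerm, im_quadForm_siegelRay, im_quadForm_siegelRay]
  apply Real.exp_le_exp.2
  set x : ℝ := n.1 + a₀ / 2
  set y : ℝ := n.2 + a₁ / 2
  have h2 : 0 ≤ 2 * (x ^ 2 + x * y + y ^ 2) := by nlinarith [sq_nonneg (x + y)]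
  have := mul_le_mul_of_nonneg_left (mul_le_mul_of_nonneg_right h h2) Real.pi_pos.le
  linarith

lemma differentiable_thetaTerm_siegelRay (τ : Matrix (Fin 2) (Fin 2) ℂ) (a₀ a₁ b₀ b₁ : ℤ)
    (n : ℤ × ℤ) : Differentiable ℂ fun s => thetaTerm a₀ a₁ b₀ b₁ (siegelRay τ s) 0 n := by
  simp only [thetaTerm, quadForm_siegelRay]
  fun_prop

lemma differentiableOn_tsum_siegelRay {τ : Matrix (Fin 2) (Fin 2) ℂ} {δ : ℝ}
    (hδ : ∀ s : ℂ, -δ ≤ s.re → PosIm (siegelRay τ s)) (a₀ a₁ b₀ b₁ : ℤ) (w : ℤ × ℤ → ℂ) {C : ℝ}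
    (hw : ∀ n, ‖w n‖ ≤ C * latticeSize n) :
    DifferentiableOn ℂ (fun s => ∑' n, w n * thetaTerm a₀ a₁ b₀ b₁ (siegelRay τ s) 0 n)
      {s : ℂ | -δ < s.re} := by
  have hsum := (summable_latticeSize_mul_norm
    (hδ (-δ : ℝ) (by rw [Complex.ofReal_re])) a₀ a₁ b₀ b₁ 0).mul_left C
  refine Complex.differentiableOn_tsum_of_summable_norm hsum
    (fun n => ((differentiable_thetaTerm_siegelRay τ a₀ a₁ b₀ b₁ n).const_mul _).differentiableOn)
    (isOpen_lt continuous_const Complex.continuous_re) fun n s hs => ?_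
  rw [norm_mul, ← mul_assoc]
  refine mul_le_mul (hw n) (norm_thetaTerm_siegelRay_le τ a₀ a₁ b₀ b₁ ?_ n) (norm_nonneg _)
    ((norm_nonneg _).trans (hw n))
  rw [Complex.ofReal_re]
  exact le_of_lt hs

lemma differentiableOn_thetaNull_siegelRay {τ : Matrix (Fin 2) (Fin 2) ℂ} {δ : ℝ}
    (hδ : ∀ s : ℂ, -δ ≤ s.re → PosIm (siegelRay τ s)) (a₀ a₁ b₀ b₁ : ℤ) :
    DifferentiableOn ℂ (fun s => thetaNull a₀ a₁ b₀ b₁ (siegelRay τ s)) {s : ℂ | -δ < s.re} := by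
  refine (differentiableOn_tsum_siegelRay hδ a₀ a₁ b₀ b₁ (fun _ => 1) (C := 1)
    fun n => ?_).congr fun s _ => ?_
  · rw [norm_one, one_mul]
    exact one_le_latticeSize n
  · simp only [thetaNull_eq_tsum, one_mul]

lemma differentiableOn_thetaDeriv_siegelRay {τ : Matrix (Fin 2) (Fin 2) ℂ} {δ : ℝ}
    (hδ : ∀ s : ℂ, -δ ≤ s.re → PosIm (siegelRay τ s)) (l : Fin 2) (a₀ a₁ b₀ b₁ : ℤ) :
    DifferentiableOn ℂ (fun s => thetaDeriv l a₀ a₁ b₀ b₁ (siegelRay τ s))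
      {s : ℂ | -δ < s.re} :=
  (differentiableOn_tsum_siegelRay hδ a₀ a₁ b₀ b₁ (fun n => derivCoeff a₀ a₁ n l)
    fun n => norm_derivCoeff_le a₀ a₁ n l).congr fun _ hs =>
      thetaDeriv_eq_tsum (hδ _ (le_of_lt hs)) l a₀ a₁ b₀ b₁

lemma eqOn_of_eventuallyEq_siegelRay {f g : ℂ → ℂ} {δ s₀ : ℝ} (hδ : 0 < δ) (hs₀ : 0 < s₀)
    (hf : DifferentiableOn ℂ f {s : ℂ | -δ < s.re})
    (hg : DifferentiableOn ℂ g {s : ℂ | -δ < s.re})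
    (hfg : ∀ s : ℂ, s₀ ≤ s.re → f s = g s) : f 0 = g 0 := by
  have hopen : IsOpen {s : ℂ | -δ < s.re} := isOpen_lt continuous_const Complex.continuous_re
  have hconv : IsPreconnected {s : ℂ | -δ < s.re} := (convex_halfSpace_re_gt _).isPreconnected
  have hmem : ((s₀ + 1 : ℝ) : ℂ) ∈ {s : ℂ | -δ < s.re} := by
    simp only [Set.mem_ofPred_eq, Complex.ofReal_re]
    linarith
  refine (hf.analyticOnNhd hopen).eqOn_of_preconnected_of_eventuallyEq (hg.analyticOnNhd hopen)
    hconv hmem ?_ (by simpa using hδ)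
  have : {s : ℂ | s₀ < s.re} ∈ nhds ((s₀ + 1 : ℝ) : ℂ) :=
    (isOpen_lt continuous_const Complex.continuous_re).mem_nhds (by simp)
  filter_upwards [this] with s hs using hfg s (le_of_lt hs)

lemma theta_two_left (a b₀ b₁ : ℤ) (z : Fin 2 → ℂ) (τ : Matrix (Fin 2) (Fin 2) ℂ) :
    theta (halfChar 2 a b₀ b₁) z τ = theta (halfChar 0 a b₀ b₁) z τ ∧
      theta (halfChar a 2 b₀ b₁) z τ = theta (halfChar a 0 b₀ b₁) z τ :=
  ⟨by simpa using theta_add_two_left 0 a b₀ b₁ 1 0 z τ,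
    by simpa using theta_add_two_left a 0 b₀ b₁ 0 1 z τ⟩

lemma theta_two_right (a₀ a₁ b : ℤ) (z : Fin 2 → ℂ) (τ : Matrix (Fin 2) (Fin 2) ℂ) :
    theta (halfChar a₀ a₁ 2 b) z τ = (-1) ^ a₀ * theta (halfChar a₀ a₁ 0 b) z τ ∧
      theta (halfChar a₀ a₁ b 2) z τ = (-1) ^ a₁ * theta (halfChar a₀ a₁ b 0) z τ :=
  ⟨by simpa using theta_add_two_right a₀ a₁ 0 b 1 0 z τ,
    by simpa using theta_add_two_right a₀ a₁ b 0 0 1 z τ⟩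

lemma thetaNull_two_left (a b₀ b₁ : ℤ) (τ : Matrix (Fin 2) (Fin 2) ℂ) :
    thetaNull 2 a b₀ b₁ τ = thetaNull 0 a b₀ b₁ τ ∧
      thetaNull a 2 b₀ b₁ τ = thetaNull a 0 b₀ b₁ τ :=
  theta_two_left a b₀ b₁ 0 τ

lemma thetaNull_two_right (a₀ a₁ b : ℤ) (τ : Matrix (Fin 2) (Fin 2) ℂ) :
    thetaNull a₀ a₁ 2 b τ = (-1) ^ a₀ * thetaNull a₀ a₁ 0 b τ ∧
      thetaNull a₀ a₁ b 2 τ = (-1) ^ a₁ * thetaNull a₀ a₁ b 0 τ :=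
  theta_two_right a₀ a₁ b 0 τ

lemma thetaNull_neg_one_right (a₀ a₁ b : ℤ) (τ : Matrix (Fin 2) (Fin 2) ℂ) :
    thetaNull a₀ a₁ (-1) b τ = (-1) ^ a₀ * thetaNull a₀ a₁ 1 b τ ∧
      thetaNull a₀ a₁ b (-1) τ = (-1) ^ a₁ * thetaNull a₀ a₁ b 1 τ := by
  have h : ∀ a : ℤ, ((-1 : ℂ) ^ a)⁻¹ = (-1) ^ a := fun a => by rw [← inv_zpow, inv_neg_one]
  exact ⟨by simpa [thetaNull, h] using theta_add_two_right a₀ a₁ 1 b (-1) 0 0 τ,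
    by simpa [thetaNull, h] using theta_add_two_right a₀ a₁ b 1 0 (-1) 0 τ⟩

lemma thetaDeriv_two_left (l : Fin 2) (a b₀ b₁ : ℤ) (τ : Matrix (Fin 2) (Fin 2) ℂ) :
    thetaDeriv l 2 a b₀ b₁ τ = thetaDeriv l 0 a b₀ b₁ τ ∧
      thetaDeriv l a 2 b₀ b₁ τ = thetaDeriv l a 0 b₀ b₁ τ := by
  simp only [thetaDeriv, fun z => (theta_two_left a b₀ b₁ z τ).1,
    fun z => (theta_two_left a b₀ b₁ z τ).2, and_self]

lemma thetaDeriv_two_right {τ : Matrix (Fin 2) (Fin 2) ℂ} (hτ : PosIm τ) (l : Fin 2)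
    (a₀ a₁ b : ℤ) :
    thetaDeriv l a₀ a₁ 2 b τ = (-1) ^ a₀ * thetaDeriv l a₀ a₁ 0 b τ ∧
      thetaDeriv l a₀ a₁ b 2 τ = (-1) ^ a₁ * thetaDeriv l a₀ a₁ b 0 τ := by
  simp only [thetaDeriv, fun z => (theta_two_right a₀ a₁ b z τ).1,
    fun z => (theta_two_right a₀ a₁ b z τ).2,
    fderiv_const_mul (hasFDerivAt_theta hτ _ _ _ _).differentiableAt,
    _root_.smul_apply, smul_eq_mul, and_self]

/-- The six odd characteristics, as numerators `(a₀, a₁, b₀, b₁)` of `[a/2; b/2]`. -/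
def oddChar : Fin 6 → ℤ × ℤ × ℤ × ℤ :=
  ![(1, 0, 1, 0), (1, 0, 1, 1), (0, 1, 0, 1), (0, 1, 1, 1), (1, 1, 1, 0), (1, 1, 0, 1)]

/-- The derivative at `0` in direction `l` of the `k`-th odd theta function. -/
def oddDeriv (l : Fin 2) (k : Fin 6) (τ : Matrix (Fin 2) (Fin 2) ℂ) : ℂ :=
  thetaDeriv l (oddChar k).1 (oddChar k).2.1 (oddChar k).2.2.1 (oddChar k).2.2.2 τ

lemma oddDeriv_eq (l : Fin 2) (τ : Matrix (Fin 2) (Fin 2) ℂ) :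
    oddDeriv l 0 τ = thetaDeriv l 1 0 1 0 τ ∧ oddDeriv l 1 τ = thetaDeriv l 1 0 1 1 τ ∧
      oddDeriv l 2 τ = thetaDeriv l 0 1 0 1 τ ∧ oddDeriv l 3 τ = thetaDeriv l 0 1 1 1 τ ∧
      oddDeriv l 4 τ = thetaDeriv l 1 1 1 0 τ ∧ oddDeriv l 5 τ = thetaDeriv l 1 1 0 1 τ :=
  ⟨rfl, rfl, rfl, rfl, rfl, rfl⟩

/-- The Jacobian Nullwert of the odd characteristics with indices `k` and `l`. -/
def oddJacobian (k l : Fin 6) (τ : Matrix (Fin 2) (Fin 2) ℂ) : ℂ :=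
  oddDeriv 0 k τ * oddDeriv 1 l τ - oddDeriv 1 k τ * oddDeriv 0 l τ

/-- The theta constant whose characteristic is the sum of the `k`-th and `l`-th odd
characteristics minus the `m`-th one. -/
def evenNull (k l m : Fin 6) (τ : Matrix (Fin 2) (Fin 2) ℂ) : ℂ :=
  thetaNull (((oddChar k).1 + (oddChar l).1 - (oddChar m).1) % 2)
    (((oddChar k).2.1 + (oddChar l).2.1 - (oddChar m).2.1) % 2)
    (((oddChar k).2.2.1 + (oddChar l).2.2.1 - (oddChar m).2.2.1) % 2)
    (((oddChar k).2.2.2 + (oddChar l).2.2.2 - (oddChar m).2.2.2) % 2) τ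

/-- The product of theta constants on the right-hand side of Rosenhain's formula. -/
def evenProd (k l : Fin 6) (τ : Matrix (Fin 2) (Fin 2) ℂ) : ℂ :=
  ∏ m ∈ Finset.univ.filter (fun m : Fin 6 => m ≠ k ∧ m ≠ l), evenNull k l m τ

lemma evenProd_eq {k l p q r s : Fin 6}
    (h : Finset.univ.filter (fun m : Fin 6 => m ≠ k ∧ m ≠ l) = {p, q, r, s})
    (hp : p ∉ ({q, r, s} : Finset (Fin 6))) (hq : q ∉ ({r, s} : Finset (Fin 6))) (hr : r ≠ s)
    (τ : Matrix (Fin 2) (Fin 2) ℂ) :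
    evenProd k l τ =
      evenNull k l p τ * (evenNull k l q τ * (evenNull k l r τ * evenNull k l s τ)) := by
  rw [evenProd, h, Finset.prod_insert hp, Finset.prod_insert hq, Finset.prod_pair hr]

lemma oddJacobian_mul_of_grad {k l A B : Fin 6} {τ τ' : Matrix (Fin 2) (Fin 2) ℂ}
    {X X' p q p' q' P P' e : ℂ}
    (h : ∀ i, oddDeriv i k τ * X = 2 * (p * oddDeriv i A τ' + q * oddDeriv i B τ'))
    (h' : ∀ i, oddDeriv i l τ * X' = 2 * (p' * oddDeriv i A τ' + q' * oddDeriv i B τ'))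
    (hP : P * (X * X') = e * (4 * (p * q' - q * p') * P')) (he : e ^ 2 = 1)
    (hX : X ≠ 0) (hX' : X' ≠ 0) :
    oddJacobian k l τ * P' = e * P * oddJacobian A B τ' := by
  have hJ : oddJacobian k l τ * (X * X') = 4 * (p * q' - q * p') * oddJacobian A B τ' := by
    have h0 := h 0
    have h1 := h 1
    have h0' := h' 0
    have h1' := h' 1
    calc oddJacobian k l τ * (X * X') =
        (oddDeriv 0 k τ * X) * (oddDeriv 1 l τ * X') -
          (oddDeriv 1 k τ * X) * (oddDeriv 0 l τ * X') := by
          rw [oddJacobian]; ring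
      _ = _ := by rw [h0, h1, h0', h1', oddJacobian]; ring
  apply mul_right_cancel₀ (mul_ne_zero hX hX')
  linear_combination P' * hJ - e * oddJacobian A B τ' * hP -
    4 * (p * q' - q * p') * P' * oddJacobian A B τ' * he

section

set_option linter.unusedSimpArgs false

lemma oddDeriv_0_mul_0_4 {τ : Matrix (Fin 2) (Fin 2) ℂ} (hτ : PosIm τ) (i : Fin 2) :
    oddDeriv i 0 τ * thetaNull 1 0 0 0 τ =
      2 * (thetaNull 0 0 1 0 ((2 : ℂ) • τ) * oddDeriv i 0 ((2 : ℂ) • τ) +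
        thetaNull 0 1 1 0 ((2 : ℂ) • τ) * oddDeriv i 4 ((2 : ℂ) • τ)) := by
  have h := thetaDeriv_mul hτ i 1 0 1 0 0 0
  simp (disch := decide) only [zero_add, add_zero, sub_zero, sub_self, Int.reduceAdd, Int.reduceSub,
    Int.reduceNeg, thetaNull_two_left, thetaNull_two_right, thetaNull_neg_one_right,
    thetaNull_eq_zero, thetaDeriv_two_left, thetaDeriv_two_right hτ.two_smul,
    thetaDeriv_eq_zero hτ, thetaDeriv_eq_zero hτ.two_smul, zpow_zero, zpow_one] at h
  simp only [oddDeriv_eq]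
  linear_combination h

lemma oddDeriv_1_mul_0_4 {τ : Matrix (Fin 2) (Fin 2) ℂ} (hτ : PosIm τ) (i : Fin 2) :
    oddDeriv i 1 τ * thetaNull 1 0 0 1 τ =
      2 * (thetaNull 0 0 1 0 ((2 : ℂ) • τ) * oddDeriv i 0 ((2 : ℂ) • τ) +
        -thetaNull 0 1 1 0 ((2 : ℂ) • τ) * oddDeriv i 4 ((2 : ℂ) • τ)) := by
  have h := thetaDeriv_mul hτ i 1 0 1 1 0 1
  simp (disch := decide) only [zero_add, add_zero, sub_zero, sub_self, Int.reduceAdd, Int.reduceSub,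
    Int.reduceNeg, thetaNull_two_left, thetaNull_two_right, thetaNull_neg_one_right,
    thetaNull_eq_zero, thetaDeriv_two_left, thetaDeriv_two_right hτ.two_smul,
    thetaDeriv_eq_zero hτ, thetaDeriv_eq_zero hτ.two_smul, zpow_zero, zpow_one] at h
  simp only [oddDeriv_eq]
  linear_combination h

lemma thetaNull_mul_0100_10 {τ : Matrix (Fin 2) (Fin 2) ℂ} (hτ : PosIm τ) :
    thetaNull 0 1 0 0 τ * thetaNull 0 1 1 0 τ =
      2 * (thetaNull 0 0 1 0 ((2 : ℂ) • τ) * thetaNull 0 1 1 0 ((2 : ℂ) • τ)) := by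
  have h := thetaNull_mul hτ 0 1 0 0 1 0
  simp (disch := decide) only [zero_add, add_zero, sub_zero, sub_self, Int.reduceAdd, Int.reduceSub,
    Int.reduceNeg, thetaNull_two_left, thetaNull_two_right, thetaNull_neg_one_right,
    thetaNull_eq_zero, zpow_zero, zpow_one] at h
  linear_combination h

lemma thetaNull_mul_1100_11 {τ : Matrix (Fin 2) (Fin 2) ℂ} (hτ : PosIm τ) :
    thetaNull 1 1 0 0 τ * thetaNull 1 1 1 1 τ =
      2 * (thetaNull 0 0 1 1 ((2 : ℂ) • τ) * thetaNull 1 1 1 1 ((2 : ℂ) • τ)) := by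
  have h := thetaNull_mul hτ 1 1 0 0 1 1
  simp (disch := decide) only [zero_add, add_zero, sub_zero, sub_self, Int.reduceAdd, Int.reduceSub,
    Int.reduceNeg, thetaNull_two_left, thetaNull_two_right, thetaNull_neg_one_right,
    thetaNull_eq_zero, zpow_zero, zpow_one] at h
  linear_combination h

lemma thetaNull_mul_1000_01 {τ : Matrix (Fin 2) (Fin 2) ℂ} (hτ : PosIm τ) :
    thetaNull 1 0 0 0 τ * thetaNull 1 0 0 1 τ =
      2 * (thetaNull 0 0 0 1 ((2 : ℂ) • τ) * thetaNull 1 0 0 1 ((2 : ℂ) • τ)) := by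
  have h := thetaNull_mul hτ 1 0 0 0 0 1
  simp (disch := decide) only [zero_add, add_zero, sub_zero, sub_self, Int.reduceAdd, Int.reduceSub,
    Int.reduceNeg, thetaNull_two_left, thetaNull_two_right, thetaNull_neg_one_right,
    thetaNull_eq_zero, zpow_zero, zpow_one] at h
  linear_combination h

lemma oddDeriv_0_mul_1_3 {τ : Matrix (Fin 2) (Fin 2) ℂ} (hτ : PosIm τ) (i : Fin 2) :
    oddDeriv i 0 τ * thetaNull 1 0 0 1 τ =
      2 * (thetaNull 0 0 1 1 ((2 : ℂ) • τ) * oddDeriv i 1 ((2 : ℂ) • τ) +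
        -thetaNull 1 1 1 1 ((2 : ℂ) • τ) * oddDeriv i 3 ((2 : ℂ) • τ)) := by
  have h := thetaDeriv_mul hτ i 1 0 1 0 0 1
  simp (disch := decide) only [zero_add, add_zero, sub_zero, sub_self, Int.reduceAdd, Int.reduceSub,
    Int.reduceNeg, thetaNull_two_left, thetaNull_two_right, thetaNull_neg_one_right,
    thetaNull_eq_zero, thetaDeriv_two_left, thetaDeriv_two_right hτ.two_smul,
    thetaDeriv_eq_zero hτ, thetaDeriv_eq_zero hτ.two_smul, zpow_zero, zpow_one] at h
  simp only [oddDeriv_eq]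
  linear_combination h

lemma oddDeriv_2_mul_1_3 {τ : Matrix (Fin 2) (Fin 2) ℂ} (hτ : PosIm τ) (i : Fin 2) :
    oddDeriv i 2 τ * thetaNull 0 1 1 0 τ =
      2 * (-thetaNull 1 1 1 1 ((2 : ℂ) • τ) * oddDeriv i 1 ((2 : ℂ) • τ) +
        thetaNull 0 0 1 1 ((2 : ℂ) • τ) * oddDeriv i 3 ((2 : ℂ) • τ)) := by
  have h := thetaDeriv_mul hτ i 0 1 0 1 1 0
  simp (disch := decide) only [zero_add, add_zero, sub_zero, sub_self, Int.reduceAdd, Int.reduceSub,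
    Int.reduceNeg, thetaNull_two_left, thetaNull_two_right, thetaNull_neg_one_right,
    thetaNull_eq_zero, thetaDeriv_two_left, thetaDeriv_two_right hτ.two_smul,
    thetaDeriv_eq_zero hτ, thetaDeriv_eq_zero hτ.two_smul, zpow_zero, zpow_one] at h
  simp only [oddDeriv_eq]
  linear_combination h

lemma thetaNull_mul_0001_10 {τ : Matrix (Fin 2) (Fin 2) ℂ} (hτ : PosIm τ) :
    thetaNull 0 0 0 1 τ * thetaNull 0 0 1 0 τ =
      thetaNull 0 0 1 1 ((2 : ℂ) • τ) * thetaNull 0 0 1 1 ((2 : ℂ) • τ) +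
        -thetaNull 1 1 1 1 ((2 : ℂ) • τ) * thetaNull 1 1 1 1 ((2 : ℂ) • τ) := by
  have h := thetaNull_mul hτ 0 0 0 1 1 0
  simp (disch := decide) only [zero_add, add_zero, sub_zero, sub_self, Int.reduceAdd, Int.reduceSub,
    Int.reduceNeg, thetaNull_two_left, thetaNull_two_right, thetaNull_neg_one_right,
    thetaNull_eq_zero, zpow_zero, zpow_one] at h
  linear_combination h

lemma oddDeriv_3_mul_1_3 {τ : Matrix (Fin 2) (Fin 2) ℂ} (hτ : PosIm τ) (i : Fin 2) :
    oddDeriv i 3 τ * thetaNull 0 1 0 0 τ =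
      2 * (thetaNull 1 1 1 1 ((2 : ℂ) • τ) * oddDeriv i 1 ((2 : ℂ) • τ) +
        thetaNull 0 0 1 1 ((2 : ℂ) • τ) * oddDeriv i 3 ((2 : ℂ) • τ)) := by
  have h := thetaDeriv_mul hτ i 0 1 1 1 0 0
  simp (disch := decide) only [zero_add, add_zero, sub_zero, sub_self, Int.reduceAdd, Int.reduceSub,
    Int.reduceNeg, thetaNull_two_left, thetaNull_two_right, thetaNull_neg_one_right,
    thetaNull_eq_zero, thetaDeriv_two_left, thetaDeriv_two_right hτ.two_smul,
    thetaDeriv_eq_zero hτ, thetaDeriv_eq_zero hτ.two_smul, zpow_zero, zpow_one] at h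
  simp only [oddDeriv_eq]
  linear_combination h

lemma thetaNull_mul_0000_11 {τ : Matrix (Fin 2) (Fin 2) ℂ} (hτ : PosIm τ) :
    thetaNull 0 0 0 0 τ * thetaNull 0 0 1 1 τ =
      thetaNull 0 0 1 1 ((2 : ℂ) • τ) * thetaNull 0 0 1 1 ((2 : ℂ) • τ) +
        thetaNull 1 1 1 1 ((2 : ℂ) • τ) * thetaNull 1 1 1 1 ((2 : ℂ) • τ) := by
  have h := thetaNull_mul hτ 0 0 0 0 1 1
  simp (disch := decide) only [zero_add, add_zero, sub_zero, sub_self, Int.reduceAdd, Int.reduceSub,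
    Int.reduceNeg, thetaNull_two_left, thetaNull_two_right, thetaNull_neg_one_right,
    thetaNull_eq_zero, zpow_zero, zpow_one] at h
  linear_combination h

lemma oddDeriv_4_mul_0_4 {τ : Matrix (Fin 2) (Fin 2) ℂ} (hτ : PosIm τ) (i : Fin 2) :
    oddDeriv i 4 τ * thetaNull 1 1 0 0 τ =
      2 * (thetaNull 0 1 1 0 ((2 : ℂ) • τ) * oddDeriv i 0 ((2 : ℂ) • τ) +
        thetaNull 0 0 1 0 ((2 : ℂ) • τ) * oddDeriv i 4 ((2 : ℂ) • τ)) := by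
  have h := thetaDeriv_mul hτ i 1 1 1 0 0 0
  simp (disch := decide) only [zero_add, add_zero, sub_zero, sub_self, Int.reduceAdd, Int.reduceSub,
    Int.reduceNeg, thetaNull_two_left, thetaNull_two_right, thetaNull_neg_one_right,
    thetaNull_eq_zero, thetaDeriv_two_left, thetaDeriv_two_right hτ.two_smul,
    thetaDeriv_eq_zero hτ, thetaDeriv_eq_zero hτ.two_smul, zpow_zero, zpow_one] at h
  simp only [oddDeriv_eq]
  linear_combination h

lemma thetaNull_mul_0001_11 {τ : Matrix (Fin 2) (Fin 2) ℂ} (hτ : PosIm τ) :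
    thetaNull 0 0 0 1 τ * thetaNull 0 0 1 1 τ =
      thetaNull 0 0 1 0 ((2 : ℂ) • τ) * thetaNull 0 0 1 0 ((2 : ℂ) • τ) +
        -thetaNull 0 1 1 0 ((2 : ℂ) • τ) * thetaNull 0 1 1 0 ((2 : ℂ) • τ) := by
  have h := thetaNull_mul hτ 0 0 0 1 1 1
  simp (disch := decide) only [zero_add, add_zero, sub_zero, sub_self, Int.reduceAdd, Int.reduceSub,
    Int.reduceNeg, thetaNull_two_left, thetaNull_two_right, thetaNull_neg_one_right,
    thetaNull_eq_zero, zpow_zero, zpow_one] at h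
  linear_combination h

lemma oddDeriv_5_mul_0_4 {τ : Matrix (Fin 2) (Fin 2) ℂ} (hτ : PosIm τ) (i : Fin 2) :
    oddDeriv i 5 τ * thetaNull 1 1 1 1 τ =
      2 * (thetaNull 0 1 1 0 ((2 : ℂ) • τ) * oddDeriv i 0 ((2 : ℂ) • τ) +
        -thetaNull 0 0 1 0 ((2 : ℂ) • τ) * oddDeriv i 4 ((2 : ℂ) • τ)) := by
  have h := thetaDeriv_mul hτ i 1 1 0 1 1 1
  simp (disch := decide) only [zero_add, add_zero, sub_zero, sub_self, Int.reduceAdd, Int.reduceSub,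
    Int.reduceNeg, thetaNull_two_left, thetaNull_two_right, thetaNull_neg_one_right,
    thetaNull_eq_zero, thetaDeriv_two_left, thetaDeriv_two_right hτ.two_smul,
    thetaDeriv_eq_zero hτ, thetaDeriv_eq_zero hτ.two_smul, zpow_zero, zpow_one] at h
  simp only [oddDeriv_eq]
  linear_combination h

lemma thetaNull_mul_0000_10 {τ : Matrix (Fin 2) (Fin 2) ℂ} (hτ : PosIm τ) :
    thetaNull 0 0 0 0 τ * thetaNull 0 0 1 0 τ =
      thetaNull 0 0 1 0 ((2 : ℂ) • τ) * thetaNull 0 0 1 0 ((2 : ℂ) • τ) +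
        thetaNull 0 1 1 0 ((2 : ℂ) • τ) * thetaNull 0 1 1 0 ((2 : ℂ) • τ) := by
  have h := thetaNull_mul hτ 0 0 0 0 1 0
  simp (disch := decide) only [zero_add, add_zero, sub_zero, sub_self, Int.reduceAdd, Int.reduceSub,
    Int.reduceNeg, thetaNull_two_left, thetaNull_two_right, thetaNull_neg_one_right,
    thetaNull_eq_zero, zpow_zero, zpow_one] at h
  linear_combination h

lemma oddDeriv_1_mul_1_3 {τ : Matrix (Fin 2) (Fin 2) ℂ} (hτ : PosIm τ) (i : Fin 2) :
    oddDeriv i 1 τ * thetaNull 1 0 0 0 τ =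
      2 * (thetaNull 0 0 1 1 ((2 : ℂ) • τ) * oddDeriv i 1 ((2 : ℂ) • τ) +
        thetaNull 1 1 1 1 ((2 : ℂ) • τ) * oddDeriv i 3 ((2 : ℂ) • τ)) := by
  have h := thetaDeriv_mul hτ i 1 0 1 1 0 0
  simp (disch := decide) only [zero_add, add_zero, sub_zero, sub_self, Int.reduceAdd, Int.reduceSub,
    Int.reduceNeg, thetaNull_two_left, thetaNull_two_right, thetaNull_neg_one_right,
    thetaNull_eq_zero, thetaDeriv_two_left, thetaDeriv_two_right hτ.two_smul,
    thetaDeriv_eq_zero hτ, thetaDeriv_eq_zero hτ.two_smul, zpow_zero, zpow_one] at h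
  simp only [oddDeriv_eq]
  linear_combination h

lemma oddDeriv_2_mul_2_5 {τ : Matrix (Fin 2) (Fin 2) ℂ} (hτ : PosIm τ) (i : Fin 2) :
    oddDeriv i 2 τ * thetaNull 0 1 0 0 τ =
      2 * (thetaNull 0 0 0 1 ((2 : ℂ) • τ) * oddDeriv i 2 ((2 : ℂ) • τ) +
        thetaNull 1 0 0 1 ((2 : ℂ) • τ) * oddDeriv i 5 ((2 : ℂ) • τ)) := by
  have h := thetaDeriv_mul hτ i 0 1 0 1 0 0
  simp (disch := decide) only [zero_add, add_zero, sub_zero, sub_self, Int.reduceAdd, Int.reduceSub,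
    Int.reduceNeg, thetaNull_two_left, thetaNull_two_right, thetaNull_neg_one_right,
    thetaNull_eq_zero, thetaDeriv_two_left, thetaDeriv_two_right hτ.two_smul,
    thetaDeriv_eq_zero hτ, thetaDeriv_eq_zero hτ.two_smul, zpow_zero, zpow_one] at h
  simp only [oddDeriv_eq]
  linear_combination h

lemma oddDeriv_3_mul_2_5 {τ : Matrix (Fin 2) (Fin 2) ℂ} (hτ : PosIm τ) (i : Fin 2) :
    oddDeriv i 3 τ * thetaNull 0 1 1 0 τ =
      2 * (thetaNull 0 0 0 1 ((2 : ℂ) • τ) * oddDeriv i 2 ((2 : ℂ) • τ) +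
        -thetaNull 1 0 0 1 ((2 : ℂ) • τ) * oddDeriv i 5 ((2 : ℂ) • τ)) := by
  have h := thetaDeriv_mul hτ i 0 1 1 1 1 0
  simp (disch := decide) only [zero_add, add_zero, sub_zero, sub_self, Int.reduceAdd, Int.reduceSub,
    Int.reduceNeg, thetaNull_two_left, thetaNull_two_right, thetaNull_neg_one_right,
    thetaNull_eq_zero, thetaDeriv_two_left, thetaDeriv_two_right hτ.two_smul,
    thetaDeriv_eq_zero hτ, thetaDeriv_eq_zero hτ.two_smul, zpow_zero, zpow_one] at h
  simp only [oddDeriv_eq]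
  linear_combination h

lemma oddDeriv_4_mul_2_5 {τ : Matrix (Fin 2) (Fin 2) ℂ} (hτ : PosIm τ) (i : Fin 2) :
    oddDeriv i 4 τ * thetaNull 1 1 1 1 τ =
      2 * (thetaNull 1 0 0 1 ((2 : ℂ) • τ) * oddDeriv i 2 ((2 : ℂ) • τ) +
        -thetaNull 0 0 0 1 ((2 : ℂ) • τ) * oddDeriv i 5 ((2 : ℂ) • τ)) := by
  have h := thetaDeriv_mul hτ i 1 1 1 0 1 1
  simp (disch := decide) only [zero_add, add_zero, sub_zero, sub_self, Int.reduceAdd, Int.reduceSub,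
    Int.reduceNeg, thetaNull_two_left, thetaNull_two_right, thetaNull_neg_one_right,
    thetaNull_eq_zero, thetaDeriv_two_left, thetaDeriv_two_right hτ.two_smul,
    thetaDeriv_eq_zero hτ, thetaDeriv_eq_zero hτ.two_smul, zpow_zero, zpow_one] at h
  simp only [oddDeriv_eq]
  linear_combination h

lemma thetaNull_mul_0000_01 {τ : Matrix (Fin 2) (Fin 2) ℂ} (hτ : PosIm τ) :
    thetaNull 0 0 0 0 τ * thetaNull 0 0 0 1 τ =
      thetaNull 0 0 0 1 ((2 : ℂ) • τ) * thetaNull 0 0 0 1 ((2 : ℂ) • τ) +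
        thetaNull 1 0 0 1 ((2 : ℂ) • τ) * thetaNull 1 0 0 1 ((2 : ℂ) • τ) := by
  have h := thetaNull_mul hτ 0 0 0 0 0 1
  simp (disch := decide) only [zero_add, add_zero, sub_zero, sub_self, Int.reduceAdd, Int.reduceSub,
    Int.reduceNeg, thetaNull_two_left, thetaNull_two_right, thetaNull_neg_one_right,
    thetaNull_eq_zero, zpow_zero, zpow_one] at h
  linear_combination h

lemma oddDeriv_5_mul_2_5 {τ : Matrix (Fin 2) (Fin 2) ℂ} (hτ : PosIm τ) (i : Fin 2) :
    oddDeriv i 5 τ * thetaNull 1 1 0 0 τ =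
      2 * (thetaNull 1 0 0 1 ((2 : ℂ) • τ) * oddDeriv i 2 ((2 : ℂ) • τ) +
        thetaNull 0 0 0 1 ((2 : ℂ) • τ) * oddDeriv i 5 ((2 : ℂ) • τ)) := by
  have h := thetaDeriv_mul hτ i 1 1 0 1 0 0
  simp (disch := decide) only [zero_add, add_zero, sub_zero, sub_self, Int.reduceAdd, Int.reduceSub,
    Int.reduceNeg, thetaNull_two_left, thetaNull_two_right, thetaNull_neg_one_right,
    thetaNull_eq_zero, thetaDeriv_two_left, thetaDeriv_two_right hτ.two_smul,
    thetaDeriv_eq_zero hτ, thetaDeriv_eq_zero hτ.two_smul, zpow_zero, zpow_one] at h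
  simp only [oddDeriv_eq]
  linear_combination h

lemma thetaNull_mul_0010_11 {τ : Matrix (Fin 2) (Fin 2) ℂ} (hτ : PosIm τ) :
    thetaNull 0 0 1 0 τ * thetaNull 0 0 1 1 τ =
      thetaNull 0 0 0 1 ((2 : ℂ) • τ) * thetaNull 0 0 0 1 ((2 : ℂ) • τ) +
        -thetaNull 1 0 0 1 ((2 : ℂ) • τ) * thetaNull 1 0 0 1 ((2 : ℂ) • τ) := by
  have h := thetaNull_mul hτ 0 0 1 0 1 1
  simp (disch := decide) only [zero_add, add_zero, sub_zero, sub_self, Int.reduceAdd, Int.reduceSub,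
    Int.reduceNeg, thetaNull_two_left, thetaNull_two_right, thetaNull_neg_one_right,
    thetaNull_eq_zero, zpow_zero, zpow_one] at h
  linear_combination h

end

lemma evenProd_0_1 (τ : Matrix (Fin 2) (Fin 2) ℂ) :
    evenProd 0 1 τ =
      thetaNull 0 1 0 0 τ * (thetaNull 0 1 1 0 τ *
        (thetaNull 1 1 1 1 τ * thetaNull 1 1 0 0 τ)) :=
  evenProd_eq (p := 2) (q := 3) (r := 4) (s := 5) (by decide) (by decide)
    (by decide) (by decide) τ

lemma evenProd_0_2 (τ : Matrix (Fin 2) (Fin 2) ℂ) :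
    evenProd 0 2 τ =
      thetaNull 0 1 0 0 τ * (thetaNull 1 0 0 0 τ *
        (thetaNull 0 0 0 1 τ * thetaNull 0 0 1 0 τ)) :=
  evenProd_eq (p := 1) (q := 3) (r := 4) (s := 5) (by decide) (by decide)
    (by decide) (by decide) τ

lemma evenProd_0_3 (τ : Matrix (Fin 2) (Fin 2) ℂ) :
    evenProd 0 3 τ =
      thetaNull 0 1 1 0 τ * (thetaNull 1 0 0 0 τ *
        (thetaNull 0 0 1 1 τ * thetaNull 0 0 0 0 τ)) :=
  evenProd_eq (p := 1) (q := 2) (r := 4) (s := 5) (by decide) (by decide)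
    (by decide) (by decide) τ

lemma evenProd_0_4 (τ : Matrix (Fin 2) (Fin 2) ℂ) :
    evenProd 0 4 τ =
      thetaNull 1 1 1 1 τ * (thetaNull 0 0 0 1 τ *
        (thetaNull 0 0 1 1 τ * thetaNull 1 0 0 1 τ)) :=
  evenProd_eq (p := 1) (q := 2) (r := 3) (s := 5) (by decide) (by decide)
    (by decide) (by decide) τ

lemma evenProd_0_5 (τ : Matrix (Fin 2) (Fin 2) ℂ) :
    evenProd 0 5 τ =
      thetaNull 1 1 0 0 τ * (thetaNull 0 0 1 0 τ *
        (thetaNull 0 0 0 0 τ * thetaNull 1 0 0 1 τ)) :=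
  evenProd_eq (p := 1) (q := 2) (r := 3) (s := 4) (by decide) (by decide)
    (by decide) (by decide) τ

lemma evenProd_1_2 (τ : Matrix (Fin 2) (Fin 2) ℂ) :
    evenProd 1 2 τ =
      thetaNull 0 1 0 0 τ * (thetaNull 1 0 0 1 τ *
        (thetaNull 0 0 0 0 τ * thetaNull 0 0 1 1 τ)) :=
  evenProd_eq (p := 0) (q := 3) (r := 4) (s := 5) (by decide) (by decide)
    (by decide) (by decide) τ

lemma evenProd_1_3 (τ : Matrix (Fin 2) (Fin 2) ℂ) :
    evenProd 1 3 τ =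
      thetaNull 0 1 1 0 τ * (thetaNull 1 0 0 1 τ *
        (thetaNull 0 0 1 0 τ * thetaNull 0 0 0 1 τ)) :=
  evenProd_eq (p := 0) (q := 2) (r := 4) (s := 5) (by decide) (by decide)
    (by decide) (by decide) τ

lemma evenProd_1_4 (τ : Matrix (Fin 2) (Fin 2) ℂ) :
    evenProd 1 4 τ =
      thetaNull 1 1 1 1 τ * (thetaNull 0 0 0 0 τ *
        (thetaNull 0 0 1 0 τ * thetaNull 1 0 0 0 τ)) :=
  evenProd_eq (p := 0) (q := 2) (r := 3) (s := 5) (by decide) (by decide)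
    (by decide) (by decide) τ

lemma evenProd_1_5 (τ : Matrix (Fin 2) (Fin 2) ℂ) :
    evenProd 1 5 τ =
      thetaNull 1 1 0 0 τ * (thetaNull 0 0 1 1 τ *
        (thetaNull 0 0 0 1 τ * thetaNull 1 0 0 0 τ)) :=
  evenProd_eq (p := 0) (q := 2) (r := 3) (s := 4) (by decide) (by decide)
    (by decide) (by decide) τ

lemma evenProd_2_3 (τ : Matrix (Fin 2) (Fin 2) ℂ) :
    evenProd 2 3 τ =
      thetaNull 1 0 0 0 τ * (thetaNull 1 0 0 1 τ *
        (thetaNull 1 1 0 0 τ * thetaNull 1 1 1 1 τ)) :=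
  evenProd_eq (p := 0) (q := 1) (r := 4) (s := 5) (by decide) (by decide)
    (by decide) (by decide) τ

lemma evenProd_2_4 (τ : Matrix (Fin 2) (Fin 2) ℂ) :
    evenProd 2 4 τ =
      thetaNull 0 0 0 1 τ * (thetaNull 0 0 0 0 τ *
        (thetaNull 1 1 0 0 τ * thetaNull 0 1 1 0 τ)) :=
  evenProd_eq (p := 0) (q := 1) (r := 3) (s := 5) (by decide) (by decide)
    (by decide) (by decide) τ

lemma evenProd_2_5 (τ : Matrix (Fin 2) (Fin 2) ℂ) :
    evenProd 2 5 τ =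
      thetaNull 0 0 1 0 τ * (thetaNull 0 0 1 1 τ *
        (thetaNull 1 1 1 1 τ * thetaNull 0 1 1 0 τ)) :=
  evenProd_eq (p := 0) (q := 1) (r := 3) (s := 4) (by decide) (by decide)
    (by decide) (by decide) τ

lemma evenProd_3_4 (τ : Matrix (Fin 2) (Fin 2) ℂ) :
    evenProd 3 4 τ =
      thetaNull 0 0 1 1 τ * (thetaNull 0 0 1 0 τ *
        (thetaNull 1 1 0 0 τ * thetaNull 0 1 0 0 τ)) :=
  evenProd_eq (p := 0) (q := 1) (r := 2) (s := 5) (by decide) (by decide)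
    (by decide) (by decide) τ

lemma evenProd_3_5 (τ : Matrix (Fin 2) (Fin 2) ℂ) :
    evenProd 3 5 τ =
      thetaNull 0 0 0 0 τ * (thetaNull 0 0 0 1 τ *
        (thetaNull 1 1 1 1 τ * thetaNull 0 1 0 0 τ)) :=
  evenProd_eq (p := 0) (q := 1) (r := 2) (s := 4) (by decide) (by decide)
    (by decide) (by decide) τ

lemma evenProd_4_5 (τ : Matrix (Fin 2) (Fin 2) ℂ) :
    evenProd 4 5 τ =
      thetaNull 1 0 0 1 τ * (thetaNull 1 0 0 0 τ *
        (thetaNull 0 1 1 0 τ * thetaNull 0 1 0 0 τ)) :=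
  evenProd_eq (p := 0) (q := 1) (r := 2) (s := 3) (by decide) (by decide)
    (by decide) (by decide) τ

lemma oddJacobian_0_1_mul {τ : Matrix (Fin 2) (Fin 2) ℂ} (hτ : PosIm τ)
    (hX : thetaNull 1 0 0 0 τ ≠ 0) (hX' : thetaNull 1 0 0 1 τ ≠ 0) :
    oddJacobian 0 1 τ * evenProd 0 4 ((2 : ℂ) • τ) =
      -1 * evenProd 0 1 τ * oddJacobian 0 4 ((2 : ℂ) • τ) := by
  refine oddJacobian_mul_of_grad (oddDeriv_0_mul_0_4 hτ) (oddDeriv_1_mul_0_4 hτ) ?_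
    (by norm_num) hX hX'
  rw [evenProd_0_1, evenProd_0_4]
  trans (thetaNull 0 1 0 0 τ * thetaNull 0 1 1 0 τ) *
    ((thetaNull 1 1 0 0 τ * thetaNull 1 1 1 1 τ) *
      (thetaNull 1 0 0 0 τ * thetaNull 1 0 0 1 τ))
  · ring
  · rw [thetaNull_mul_0100_10 hτ, thetaNull_mul_1100_11 hτ, thetaNull_mul_1000_01 hτ]
    ring

lemma oddJacobian_0_2_mul {τ : Matrix (Fin 2) (Fin 2) ℂ} (hτ : PosIm τ)
    (hX : thetaNull 1 0 0 1 τ ≠ 0) (hX' : thetaNull 0 1 1 0 τ ≠ 0) :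
    oddJacobian 0 2 τ * evenProd 1 3 ((2 : ℂ) • τ) =
      1 * evenProd 0 2 τ * oddJacobian 1 3 ((2 : ℂ) • τ) := by
  refine oddJacobian_mul_of_grad (oddDeriv_0_mul_1_3 hτ) (oddDeriv_2_mul_1_3 hτ) ?_
    (by norm_num) hX hX'
  rw [evenProd_0_2, evenProd_1_3]
  trans (thetaNull 0 1 0 0 τ * thetaNull 0 1 1 0 τ) *
    ((thetaNull 1 0 0 0 τ * thetaNull 1 0 0 1 τ) *
      (thetaNull 0 0 0 1 τ * thetaNull 0 0 1 0 τ))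
  · ring
  · rw [thetaNull_mul_0100_10 hτ, thetaNull_mul_1000_01 hτ, thetaNull_mul_0001_10 hτ]
    ring

lemma oddJacobian_0_3_mul {τ : Matrix (Fin 2) (Fin 2) ℂ} (hτ : PosIm τ)
    (hX : thetaNull 1 0 0 1 τ ≠ 0) (hX' : thetaNull 0 1 0 0 τ ≠ 0) :
    oddJacobian 0 3 τ * evenProd 1 3 ((2 : ℂ) • τ) =
      1 * evenProd 0 3 τ * oddJacobian 1 3 ((2 : ℂ) • τ) := by
  refine oddJacobian_mul_of_grad (oddDeriv_0_mul_1_3 hτ) (oddDeriv_3_mul_1_3 hτ) ?_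
    (by norm_num) hX hX'
  rw [evenProd_0_3, evenProd_1_3]
  trans (thetaNull 0 1 0 0 τ * thetaNull 0 1 1 0 τ) *
    ((thetaNull 1 0 0 0 τ * thetaNull 1 0 0 1 τ) *
      (thetaNull 0 0 0 0 τ * thetaNull 0 0 1 1 τ))
  · ring
  · rw [thetaNull_mul_0100_10 hτ, thetaNull_mul_1000_01 hτ, thetaNull_mul_0000_11 hτ]
    ring

lemma oddJacobian_0_4_mul {τ : Matrix (Fin 2) (Fin 2) ℂ} (hτ : PosIm τ)
    (hX : thetaNull 1 0 0 0 τ ≠ 0) (hX' : thetaNull 1 1 0 0 τ ≠ 0) :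
    oddJacobian 0 4 τ * evenProd 0 4 ((2 : ℂ) • τ) =
      1 * evenProd 0 4 τ * oddJacobian 0 4 ((2 : ℂ) • τ) := by
  refine oddJacobian_mul_of_grad (oddDeriv_0_mul_0_4 hτ) (oddDeriv_4_mul_0_4 hτ) ?_
    (by norm_num) hX hX'
  rw [evenProd_0_4, evenProd_0_4]
  trans (thetaNull 1 1 0 0 τ * thetaNull 1 1 1 1 τ) *
    ((thetaNull 0 0 0 1 τ * thetaNull 0 0 1 1 τ) *
      (thetaNull 1 0 0 0 τ * thetaNull 1 0 0 1 τ))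
  · ring
  · rw [thetaNull_mul_1100_11 hτ, thetaNull_mul_0001_11 hτ, thetaNull_mul_1000_01 hτ]
    ring

lemma oddJacobian_0_5_mul {τ : Matrix (Fin 2) (Fin 2) ℂ} (hτ : PosIm τ)
    (hX : thetaNull 1 0 0 0 τ ≠ 0) (hX' : thetaNull 1 1 1 1 τ ≠ 0) :
    oddJacobian 0 5 τ * evenProd 0 4 ((2 : ℂ) • τ) =
      -1 * evenProd 0 5 τ * oddJacobian 0 4 ((2 : ℂ) • τ) := by
  refine oddJacobian_mul_of_grad (oddDeriv_0_mul_0_4 hτ) (oddDeriv_5_mul_0_4 hτ) ?_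
    (by norm_num) hX hX'
  rw [evenProd_0_5, evenProd_0_4]
  trans (thetaNull 1 1 0 0 τ * thetaNull 1 1 1 1 τ) *
    ((thetaNull 0 0 0 0 τ * thetaNull 0 0 1 0 τ) *
      (thetaNull 1 0 0 0 τ * thetaNull 1 0 0 1 τ))
  · ring
  · rw [thetaNull_mul_1100_11 hτ, thetaNull_mul_0000_10 hτ, thetaNull_mul_1000_01 hτ]
    ring

lemma oddJacobian_1_2_mul {τ : Matrix (Fin 2) (Fin 2) ℂ} (hτ : PosIm τ)
    (hX : thetaNull 1 0 0 0 τ ≠ 0) (hX' : thetaNull 0 1 1 0 τ ≠ 0) :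
    oddJacobian 1 2 τ * evenProd 1 3 ((2 : ℂ) • τ) =
      1 * evenProd 1 2 τ * oddJacobian 1 3 ((2 : ℂ) • τ) := by
  refine oddJacobian_mul_of_grad (oddDeriv_1_mul_1_3 hτ) (oddDeriv_2_mul_1_3 hτ) ?_
    (by norm_num) hX hX'
  rw [evenProd_1_2, evenProd_1_3]
  trans (thetaNull 0 1 0 0 τ * thetaNull 0 1 1 0 τ) *
    ((thetaNull 1 0 0 0 τ * thetaNull 1 0 0 1 τ) *
      (thetaNull 0 0 0 0 τ * thetaNull 0 0 1 1 τ))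
  · ring
  · rw [thetaNull_mul_0100_10 hτ, thetaNull_mul_1000_01 hτ, thetaNull_mul_0000_11 hτ]
    ring

lemma oddJacobian_1_3_mul {τ : Matrix (Fin 2) (Fin 2) ℂ} (hτ : PosIm τ)
    (hX : thetaNull 1 0 0 0 τ ≠ 0) (hX' : thetaNull 0 1 0 0 τ ≠ 0) :
    oddJacobian 1 3 τ * evenProd 1 3 ((2 : ℂ) • τ) =
      1 * evenProd 1 3 τ * oddJacobian 1 3 ((2 : ℂ) • τ) := by
  refine oddJacobian_mul_of_grad (oddDeriv_1_mul_1_3 hτ) (oddDeriv_3_mul_1_3 hτ) ?_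
    (by norm_num) hX hX'
  rw [evenProd_1_3, evenProd_1_3]
  trans (thetaNull 0 1 0 0 τ * thetaNull 0 1 1 0 τ) *
    ((thetaNull 1 0 0 0 τ * thetaNull 1 0 0 1 τ) *
      (thetaNull 0 0 0 1 τ * thetaNull 0 0 1 0 τ))
  · ring
  · rw [thetaNull_mul_0100_10 hτ, thetaNull_mul_1000_01 hτ, thetaNull_mul_0001_10 hτ]
    ring

lemma oddJacobian_1_4_mul {τ : Matrix (Fin 2) (Fin 2) ℂ} (hτ : PosIm τ)
    (hX : thetaNull 1 0 0 1 τ ≠ 0) (hX' : thetaNull 1 1 0 0 τ ≠ 0) :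
    oddJacobian 1 4 τ * evenProd 0 4 ((2 : ℂ) • τ) =
      1 * evenProd 1 4 τ * oddJacobian 0 4 ((2 : ℂ) • τ) := by
  refine oddJacobian_mul_of_grad (oddDeriv_1_mul_0_4 hτ) (oddDeriv_4_mul_0_4 hτ) ?_
    (by norm_num) hX hX'
  rw [evenProd_1_4, evenProd_0_4]
  trans (thetaNull 1 1 0 0 τ * thetaNull 1 1 1 1 τ) *
    ((thetaNull 0 0 0 0 τ * thetaNull 0 0 1 0 τ) *
      (thetaNull 1 0 0 0 τ * thetaNull 1 0 0 1 τ))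
  · ring
  · rw [thetaNull_mul_1100_11 hτ, thetaNull_mul_0000_10 hτ, thetaNull_mul_1000_01 hτ]
    ring

lemma oddJacobian_1_5_mul {τ : Matrix (Fin 2) (Fin 2) ℂ} (hτ : PosIm τ)
    (hX : thetaNull 1 0 0 1 τ ≠ 0) (hX' : thetaNull 1 1 1 1 τ ≠ 0) :
    oddJacobian 1 5 τ * evenProd 0 4 ((2 : ℂ) • τ) =
      -1 * evenProd 1 5 τ * oddJacobian 0 4 ((2 : ℂ) • τ) := by
  refine oddJacobian_mul_of_grad (oddDeriv_1_mul_0_4 hτ) (oddDeriv_5_mul_0_4 hτ) ?_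
    (by norm_num) hX hX'
  rw [evenProd_1_5, evenProd_0_4]
  trans (thetaNull 1 1 0 0 τ * thetaNull 1 1 1 1 τ) *
    ((thetaNull 0 0 0 1 τ * thetaNull 0 0 1 1 τ) *
      (thetaNull 1 0 0 0 τ * thetaNull 1 0 0 1 τ))
  · ring
  · rw [thetaNull_mul_1100_11 hτ, thetaNull_mul_0001_11 hτ, thetaNull_mul_1000_01 hτ]
    ring

lemma oddJacobian_2_3_mul {τ : Matrix (Fin 2) (Fin 2) ℂ} (hτ : PosIm τ)
    (hX : thetaNull 0 1 0 0 τ ≠ 0) (hX' : thetaNull 0 1 1 0 τ ≠ 0) :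
    oddJacobian 2 3 τ * evenProd 2 5 ((2 : ℂ) • τ) =
      -1 * evenProd 2 3 τ * oddJacobian 2 5 ((2 : ℂ) • τ) := by
  refine oddJacobian_mul_of_grad (oddDeriv_2_mul_2_5 hτ) (oddDeriv_3_mul_2_5 hτ) ?_
    (by norm_num) hX hX'
  rw [evenProd_2_3, evenProd_2_5]
  trans (thetaNull 1 0 0 0 τ * thetaNull 1 0 0 1 τ) *
    ((thetaNull 1 1 0 0 τ * thetaNull 1 1 1 1 τ) *
      (thetaNull 0 1 0 0 τ * thetaNull 0 1 1 0 τ))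
  · ring
  · rw [thetaNull_mul_1000_01 hτ, thetaNull_mul_1100_11 hτ, thetaNull_mul_0100_10 hτ]
    ring

lemma oddJacobian_2_4_mul {τ : Matrix (Fin 2) (Fin 2) ℂ} (hτ : PosIm τ)
    (hX : thetaNull 0 1 0 0 τ ≠ 0) (hX' : thetaNull 1 1 1 1 τ ≠ 0) :
    oddJacobian 2 4 τ * evenProd 2 5 ((2 : ℂ) • τ) =
      -1 * evenProd 2 4 τ * oddJacobian 2 5 ((2 : ℂ) • τ) := by
  refine oddJacobian_mul_of_grad (oddDeriv_2_mul_2_5 hτ) (oddDeriv_4_mul_2_5 hτ) ?_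
    (by norm_num) hX hX'
  rw [evenProd_2_4, evenProd_2_5]
  trans (thetaNull 0 0 0 0 τ * thetaNull 0 0 0 1 τ) *
    ((thetaNull 1 1 0 0 τ * thetaNull 1 1 1 1 τ) *
      (thetaNull 0 1 0 0 τ * thetaNull 0 1 1 0 τ))
  · ring
  · rw [thetaNull_mul_0000_01 hτ, thetaNull_mul_1100_11 hτ, thetaNull_mul_0100_10 hτ]
    ring

lemma oddJacobian_2_5_mul {τ : Matrix (Fin 2) (Fin 2) ℂ} (hτ : PosIm τ)
    (hX : thetaNull 0 1 0 0 τ ≠ 0) (hX' : thetaNull 1 1 0 0 τ ≠ 0) :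
    oddJacobian 2 5 τ * evenProd 2 5 ((2 : ℂ) • τ) =
      1 * evenProd 2 5 τ * oddJacobian 2 5 ((2 : ℂ) • τ) := by
  refine oddJacobian_mul_of_grad (oddDeriv_2_mul_2_5 hτ) (oddDeriv_5_mul_2_5 hτ) ?_
    (by norm_num) hX hX'
  rw [evenProd_2_5, evenProd_2_5]
  trans (thetaNull 0 0 1 0 τ * thetaNull 0 0 1 1 τ) *
    ((thetaNull 1 1 0 0 τ * thetaNull 1 1 1 1 τ) *
      (thetaNull 0 1 0 0 τ * thetaNull 0 1 1 0 τ))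
  · ring
  · rw [thetaNull_mul_0010_11 hτ, thetaNull_mul_1100_11 hτ, thetaNull_mul_0100_10 hτ]
    ring

lemma oddJacobian_3_4_mul {τ : Matrix (Fin 2) (Fin 2) ℂ} (hτ : PosIm τ)
    (hX : thetaNull 0 1 1 0 τ ≠ 0) (hX' : thetaNull 1 1 1 1 τ ≠ 0) :
    oddJacobian 3 4 τ * evenProd 2 5 ((2 : ℂ) • τ) =
      -1 * evenProd 3 4 τ * oddJacobian 2 5 ((2 : ℂ) • τ) := by
  refine oddJacobian_mul_of_grad (oddDeriv_3_mul_2_5 hτ) (oddDeriv_4_mul_2_5 hτ) ?_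
    (by norm_num) hX hX'
  rw [evenProd_3_4, evenProd_2_5]
  trans (thetaNull 0 0 1 0 τ * thetaNull 0 0 1 1 τ) *
    ((thetaNull 1 1 0 0 τ * thetaNull 1 1 1 1 τ) *
      (thetaNull 0 1 0 0 τ * thetaNull 0 1 1 0 τ))
  · ring
  · rw [thetaNull_mul_0010_11 hτ, thetaNull_mul_1100_11 hτ, thetaNull_mul_0100_10 hτ]
    ring

lemma oddJacobian_3_5_mul {τ : Matrix (Fin 2) (Fin 2) ℂ} (hτ : PosIm τ)
    (hX : thetaNull 0 1 1 0 τ ≠ 0) (hX' : thetaNull 1 1 0 0 τ ≠ 0) :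
    oddJacobian 3 5 τ * evenProd 2 5 ((2 : ℂ) • τ) =
      1 * evenProd 3 5 τ * oddJacobian 2 5 ((2 : ℂ) • τ) := by
  refine oddJacobian_mul_of_grad (oddDeriv_3_mul_2_5 hτ) (oddDeriv_5_mul_2_5 hτ) ?_
    (by norm_num) hX hX'
  rw [evenProd_3_5, evenProd_2_5]
  trans (thetaNull 0 0 0 0 τ * thetaNull 0 0 0 1 τ) *
    ((thetaNull 1 1 0 0 τ * thetaNull 1 1 1 1 τ) *
      (thetaNull 0 1 0 0 τ * thetaNull 0 1 1 0 τ))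
  · ring
  · rw [thetaNull_mul_0000_01 hτ, thetaNull_mul_1100_11 hτ, thetaNull_mul_0100_10 hτ]
    ring

lemma oddJacobian_4_5_mul {τ : Matrix (Fin 2) (Fin 2) ℂ} (hτ : PosIm τ)
    (hX : thetaNull 1 1 0 0 τ ≠ 0) (hX' : thetaNull 1 1 1 1 τ ≠ 0) :
    oddJacobian 4 5 τ * evenProd 0 4 ((2 : ℂ) • τ) =
      -1 * evenProd 4 5 τ * oddJacobian 0 4 ((2 : ℂ) • τ) := by
  refine oddJacobian_mul_of_grad (oddDeriv_4_mul_0_4 hτ) (oddDeriv_5_mul_0_4 hτ) ?_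
    (by norm_num) hX hX'
  rw [evenProd_4_5, evenProd_0_4]
  trans (thetaNull 1 0 0 0 τ * thetaNull 1 0 0 1 τ) *
    ((thetaNull 0 1 0 0 τ * thetaNull 0 1 1 0 τ) *
      (thetaNull 1 1 0 0 τ * thetaNull 1 1 1 1 τ))
  · ring
  · rw [thetaNull_mul_1000_01 hτ, thetaNull_mul_0100_10 hτ, thetaNull_mul_1100_11 hτ]
    ring

lemma leadExp_zero_zero (τ : Matrix (Fin 2) (Fin 2) ℂ) : leadExp 0 0 τ = 1 := by
  simp [leadExp, quadForm]

lemma eq_mul_of_tendsto_div {f g E : ℕ → ℂ} {α β : ℂ} (hfg : ∀ N, f N * g (N + 1) = g N * f (N + 1))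
    (hg : ∀ N, g N ≠ 0) (hE : ∀ N, E N ≠ 0)
    (hf : Filter.Tendsto (fun N => f N / E N) Filter.atTop (nhds α))
    (hg' : Filter.Tendsto (fun N => g N / E N) Filter.atTop (nhds β)) (hβ : β ≠ 0) :
    f 0 = α / β * g 0 := by
  have hconst : ∀ N, f N / g N = f 0 / g 0 := by
    intro N
    induction N with
    | zero => rfl
    | succ N ih =>
      rw [← ih, div_eq_div_iff (hg _) (hg _)]
      linear_combination -hfg N
  have hlim := hf.div hg' hβ
  have hlim' := hlim.congr (f₂ := fun _ => f 0 / g 0) fun N => by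
    rw [Pi.div_apply, div_div_div_cancel_right₀ (hE N), hconst]
  rw [tendsto_nhds_unique hlim' tendsto_const_nhds, div_mul_cancel₀ _ (hg 0)]

/-- The product of the leading exponentials of two odd theta functions. -/
def oddExp (k l : Fin 6) (τ : Matrix (Fin 2) (Fin 2) ℂ) : ℂ :=
  leadExp (oddChar k).1 (oddChar k).2.1 τ * leadExp (oddChar l).1 (oddChar l).2.1 τ

/-- The leading coefficient of `oddDeriv`. -/
def oddLead (l : Fin 2) (k : Fin 6) : ℂ :=
  leadDeriv l (oddChar k).1 (oddChar k).2.1 (oddChar k).2.2.1 (oddChar k).2.2.2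

lemma oddLead_zero (l : Fin 2) : oddLead l 0 = (![-2 * (Real.pi : ℂ), 0] : Fin 2 → ℂ) l :=
  leadDeriv_one_zero l 0

lemma oddLead_one (l : Fin 2) : oddLead l 1 = (![-2 * (Real.pi : ℂ), 0] : Fin 2 → ℂ) l :=
  leadDeriv_one_zero l 1

lemma oddLead_two (l : Fin 2) : oddLead l 2 = (![0, -2 * (Real.pi : ℂ)] : Fin 2 → ℂ) l :=
  leadDeriv_zero_one l 0

lemma oddLead_three (l : Fin 2) : oddLead l 3 = (![0, -2 * (Real.pi : ℂ)] : Fin 2 → ℂ) l :=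
  leadDeriv_zero_one l 1

lemma oddLead_four (l : Fin 2) :
    oddLead l 4 = (![-2 * (Real.pi : ℂ), 2 * (Real.pi : ℂ)] : Fin 2 → ℂ) l :=
  leadDeriv_one_one_one_zero l

lemma oddLead_five (l : Fin 2) :
    oddLead l 5 = (![2 * (Real.pi : ℂ), -2 * (Real.pi : ℂ)] : Fin 2 → ℂ) l :=
  leadDeriv_one_one_zero_one l

lemma tendsto_oddDeriv_div {r : ℝ} {τ : Matrix (Fin 2) (Fin 2) ℂ} (h : LeadDominant r τ)
    (hr : 0 < r) (l : Fin 2) (k : Fin 6) :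
    Filter.Tendsto
      (fun N : ℕ => oddDeriv l k ((2 : ℂ) ^ N • τ) /
        leadExp (oddChar k).1 (oddChar k).2.1 ((2 : ℂ) ^ N • τ)) Filter.atTop
      (nhds (oddLead l k)) :=
  tendsto_thetaDeriv_div h hr l _ _ (by fin_cases k <;> simp [oddChar])
    (by fin_cases k <;> simp [oddChar])

lemma tendsto_oddJacobian_div {r : ℝ} {τ : Matrix (Fin 2) (Fin 2) ℂ} (h : LeadDominant r τ)
    (hr : 0 < r) {k l : Fin 6} {u v : Fin 2 → ℂ}
    (hk : ∀ i, oddLead i k = u i) (hl : ∀ i, oddLead i l = v i) :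
    Filter.Tendsto
      (fun N : ℕ => oddJacobian k l ((2 : ℂ) ^ N • τ) / oddExp k l ((2 : ℂ) ^ N • τ))
      Filter.atTop (nhds (u 0 * v 1 - u 1 * v 0)) := by
  have hu := fun i => hk i ▸ tendsto_oddDeriv_div h hr i k
  have hv := fun i => hl i ▸ tendsto_oddDeriv_div h hr i l
  refine (((hu 0).mul (hv 1)).sub ((hu 1).mul (hv 0))).congr fun N => ?_
  rw [oddJacobian, oddExp]
  ring

lemma tendsto_evenProd_0_4_div {r : ℝ} {τ : Matrix (Fin 2) (Fin 2) ℂ} (h : LeadDominant r τ)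
    (hr : 0 < r) :
    Filter.Tendsto (fun N : ℕ => evenProd 0 4 ((2 : ℂ) ^ N • τ) / oddExp 0 4 ((2 : ℂ) ^ N • τ))
      Filter.atTop (nhds 4) := by
  have h1 := leadNull_one_one 1 ▸ tendsto_thetaNull_div h hr 1 1 (.inr rfl) (.inr rfl)
  have h2 := leadNull_zero_zero 0 1 ▸ tendsto_thetaNull_div h hr 0 1 (.inl rfl) (.inl rfl)
  have h3 := leadNull_zero_zero 1 1 ▸ tendsto_thetaNull_div h hr 1 1 (.inl rfl) (.inl rfl)
  have h4 := leadNull_one_zero 1 ▸ tendsto_thetaNull_div h hr 0 1 (.inr rfl) (.inl rfl)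
  have := h1.mul (h2.mul (h3.mul h4))
  norm_num at this
  refine this.congr fun N => ?_
  simp only [evenProd_0_4, oddExp, oddChar, Matrix.cons_val, leadExp_zero_zero]
  ring

lemma tendsto_evenProd_1_3_div {r : ℝ} {τ : Matrix (Fin 2) (Fin 2) ℂ} (h : LeadDominant r τ)
    (hr : 0 < r) :
    Filter.Tendsto (fun N : ℕ => evenProd 1 3 ((2 : ℂ) ^ N • τ) / oddExp 1 3 ((2 : ℂ) ^ N • τ))
      Filter.atTop (nhds 4) := by
  have h1 := leadNull_zero_one 1 ▸ tendsto_thetaNull_div h hr 1 0 (.inl rfl) (.inr rfl)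
  have h2 := leadNull_one_zero 1 ▸ tendsto_thetaNull_div h hr 0 1 (.inr rfl) (.inl rfl)
  have h3 := leadNull_zero_zero 1 0 ▸ tendsto_thetaNull_div h hr 1 0 (.inl rfl) (.inl rfl)
  have h4 := leadNull_zero_zero 0 1 ▸ tendsto_thetaNull_div h hr 0 1 (.inl rfl) (.inl rfl)
  have := h1.mul (h2.mul (h3.mul h4))
  norm_num at this
  refine this.congr fun N => ?_
  simp only [evenProd_1_3, oddExp, oddChar, Matrix.cons_val, leadExp_zero_zero]
  ring

lemma tendsto_evenProd_2_5_div {r : ℝ} {τ : Matrix (Fin 2) (Fin 2) ℂ} (h : LeadDominant r τ)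
    (hr : 0 < r) :
    Filter.Tendsto (fun N : ℕ => evenProd 2 5 ((2 : ℂ) ^ N • τ) / oddExp 2 5 ((2 : ℂ) ^ N • τ))
      Filter.atTop (nhds 4) := by
  have h1 := leadNull_zero_zero 1 0 ▸ tendsto_thetaNull_div h hr 1 0 (.inl rfl) (.inl rfl)
  have h2 := leadNull_zero_zero 1 1 ▸ tendsto_thetaNull_div h hr 1 1 (.inl rfl) (.inl rfl)
  have h3 := leadNull_one_one 1 ▸ tendsto_thetaNull_div h hr 1 1 (.inr rfl) (.inr rfl)
  have h4 := leadNull_zero_one 1 ▸ tendsto_thetaNull_div h hr 1 0 (.inl rfl) (.inr rfl)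
  have := h1.mul (h2.mul (h3.mul h4))
  norm_num at this
  refine this.congr fun N => ?_
  simp only [evenProd_2_5, oddExp, oddChar, Matrix.cons_val, leadExp_zero_zero]
  ring

/-- None of the ten even theta constants vanishes at `τ`. -/
structure EvenNonvanishing (τ : Matrix (Fin 2) (Fin 2) ℂ) : Prop where
  zero_zero : ∀ b₀ b₁, thetaNull 0 0 b₀ b₁ τ ≠ 0
  one_zero : ∀ b₁, thetaNull 1 0 0 b₁ τ ≠ 0
  zero_one : ∀ b₀, thetaNull 0 1 b₀ 0 τ ≠ 0
  one_one : ∀ b, thetaNull 1 1 b b τ ≠ 0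

/-- The part of the Siegel half-space where the leading terms of all theta series dominate. -/
structure LeadRegion (τ : Matrix (Fin 2) (Fin 2) ℂ) : Prop where
  dominant : ∃ r > 0, LeadDominant r τ
  nonvanishing : ∀ N : ℕ, EvenNonvanishing ((2 : ℂ) ^ N • τ)

lemma LeadRegion.posIm {τ : Matrix (Fin 2) (Fin 2) ℂ} (h : LeadRegion τ) : PosIm τ := by
  obtain ⟨r, -, hr⟩ := h.dominant
  exact hr.posIm

lemma LeadRegion.evenNonvanishing {τ : Matrix (Fin 2) (Fin 2) ℂ} (h : LeadRegion τ) :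
    EvenNonvanishing τ := by
  simpa using h.nonvanishing 0

lemma LeadRegion.two_smul {τ : Matrix (Fin 2) (Fin 2) ℂ} (h : LeadRegion τ) :
    LeadRegion ((2 : ℂ) • τ) := by
  obtain ⟨r, hr, hd⟩ := h.dominant
  refine ⟨⟨2 * r, by linarith, hd.two_smul⟩, fun N => ?_⟩
  rw [smul_smul, ← pow_succ]
  exact h.nonvanishing (N + 1)

lemma LeadRegion.pow_smul {τ : Matrix (Fin 2) (Fin 2) ℂ} (h : LeadRegion τ) (N : ℕ) :
    LeadRegion ((2 : ℂ) ^ N • τ) := by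
  induction N with
  | zero => simpa using h
  | succ N ih =>
    rw [pow_succ', mul_smul]
    exact ih.two_smul

lemma exists_leadRegion : ∃ R : ℝ, 0 < R ∧ ∀ τ, LeadDominant R τ → LeadRegion τ := by
  obtain ⟨R, hR, h⟩ := exists_leadDominant_thetaNull_ne_zero
  refine ⟨R, hR, fun τ hτ => ⟨⟨R, hR, hτ⟩, fun N => ?_⟩⟩
  have hN := h _ ((hτ.pow_smul N).mono (le_mul_of_one_le_left hR.le (one_le_pow₀ one_le_two)))
  exact ⟨fun b₀ b₁ => hN _ _ _ _ (.inl rfl) (.inl rfl) (by norm_num [leadNull_zero_zero]),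
    fun b₁ => hN _ _ _ _ (.inr rfl) (.inl rfl) (by norm_num [leadNull_one_zero]),
    fun b₀ => hN _ _ _ _ (.inl rfl) (.inr rfl) (by norm_num [leadNull_zero_one]),
    fun b => hN _ _ _ _ (.inr rfl) (.inr rfl) (by norm_num [leadNull_one_one])⟩

lemma oddJacobian_eq_of_tendsto {k l : Fin 6} {u v : Fin 2 → ℂ} {ε : ℂ}
    (hk : ∀ i, oddLead i k = u i) (hl : ∀ i, oddLead i l = v i)
    (hP : ∀ {r : ℝ} {τ : Matrix (Fin 2) (Fin 2) ℂ}, LeadDominant r τ → 0 < r →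
      Filter.Tendsto (fun N : ℕ => evenProd k l ((2 : ℂ) ^ N • τ) / oddExp k l ((2 : ℂ) ^ N • τ))
        Filter.atTop (nhds 4))
    (hne : ∀ τ, EvenNonvanishing τ → evenProd k l τ ≠ 0)
    (hmul : ∀ τ, PosIm τ → EvenNonvanishing τ →
      oddJacobian k l τ * evenProd k l ((2 : ℂ) • τ) =
        1 * evenProd k l τ * oddJacobian k l ((2 : ℂ) • τ))
    (huv : u 0 * v 1 - u 1 * v 0 = 4 * (ε * (Real.pi : ℂ) ^ 2))
    {τ : Matrix (Fin 2) (Fin 2) ℂ} (h : LeadRegion τ) :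
    oddJacobian k l τ = ε * (Real.pi : ℂ) ^ 2 * evenProd k l τ := by
  obtain ⟨r, hr, hd⟩ := h.dominant
  have key := eq_mul_of_tendsto_div (fun N => ?_) (fun N => hne _ (h.nonvanishing N)) (fun N => ?_)
    (tendsto_oddJacobian_div hd hr hk hl) (hP hd hr) (by norm_num)
  · rw [huv, mul_div_cancel_left₀ _ (by norm_num)] at key
    simpa using key
  · have := hmul _ (h.pow_smul N).posIm (h.nonvanishing N)
    rwa [smul_smul, ← pow_succ', one_mul] at this
  · exact mul_ne_zero (leadExp_ne_zero _ _ _) (leadExp_ne_zero _ _ _)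

lemma evenProd_0_4_ne_zero {τ : Matrix (Fin 2) (Fin 2) ℂ} (h : EvenNonvanishing τ) :
    evenProd 0 4 τ ≠ 0 := by
  rw [evenProd_0_4]
  exact mul_ne_zero (h.one_one 1) (mul_ne_zero (h.zero_zero _ _)
    (mul_ne_zero (h.zero_zero _ _) (h.one_zero 1)))

lemma evenProd_1_3_ne_zero {τ : Matrix (Fin 2) (Fin 2) ℂ} (h : EvenNonvanishing τ) :
    evenProd 1 3 τ ≠ 0 := by
  rw [evenProd_1_3]
  exact mul_ne_zero (h.zero_one 1) (mul_ne_zero (h.one_zero 1)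
    (mul_ne_zero (h.zero_zero _ _) (h.zero_zero _ _)))

lemma evenProd_2_5_ne_zero {τ : Matrix (Fin 2) (Fin 2) ℂ} (h : EvenNonvanishing τ) :
    evenProd 2 5 τ ≠ 0 := by
  rw [evenProd_2_5]
  exact mul_ne_zero (h.zero_zero _ _) (mul_ne_zero (h.zero_zero _ _)
    (mul_ne_zero (h.one_one 1) (h.zero_one 1)))

lemma oddJacobian_0_4 {τ : Matrix (Fin 2) (Fin 2) ℂ} (h : LeadRegion τ) :
    oddJacobian 0 4 τ = -1 * (Real.pi : ℂ) ^ 2 * evenProd 0 4 τ := by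
  refine oddJacobian_eq_of_tendsto oddLead_zero oddLead_four
    tendsto_evenProd_0_4_div (fun _ h => evenProd_0_4_ne_zero h)
    (fun _ hτ h => oddJacobian_0_4_mul hτ (h.one_zero 0) (h.one_one 0)) ?_ h
  norm_num
  ring

lemma oddJacobian_1_3 {τ : Matrix (Fin 2) (Fin 2) ℂ} (h : LeadRegion τ) :
    oddJacobian 1 3 τ = 1 * (Real.pi : ℂ) ^ 2 * evenProd 1 3 τ := by
  refine oddJacobian_eq_of_tendsto oddLead_one oddLead_three
    tendsto_evenProd_1_3_div (fun _ h => evenProd_1_3_ne_zero h)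
    (fun _ hτ h => oddJacobian_1_3_mul hτ (h.one_zero 0) (h.zero_one 0)) ?_ h
  norm_num
  ring

lemma oddJacobian_2_5 {τ : Matrix (Fin 2) (Fin 2) ℂ} (h : LeadRegion τ) :
    oddJacobian 2 5 τ = 1 * (Real.pi : ℂ) ^ 2 * evenProd 2 5 τ := by
  refine oddJacobian_eq_of_tendsto oddLead_two oddLead_five
    tendsto_evenProd_2_5_div (fun _ h => evenProd_2_5_ne_zero h)
    (fun _ hτ h => oddJacobian_2_5_mul hτ (h.zero_one 0) (h.one_one 0)) ?_ h
  norm_num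
  ring

/-- Rosenhain's formula, up to sign, on the region where leading terms dominate. -/
structure RosenhainOnLead (k l : Fin 6) : Prop where
  exists_sign : ∃ ε : ℂ, (ε = 1 ∨ ε = -1) ∧
    ∀ τ, LeadRegion τ → oddJacobian k l τ = ε * (Real.pi : ℂ) ^ 2 * evenProd k l τ

lemma RosenhainOnLead.of_mul {k l A B : Fin 6} {e : ℂ} (he : e = 1 ∨ e = -1)
    (hbase : RosenhainOnLead A B) (hne : ∀ {τ}, EvenNonvanishing τ → evenProd A B τ ≠ 0)
    (hmul : ∀ {τ}, PosIm τ → EvenNonvanishing τ →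
      oddJacobian k l τ * evenProd A B ((2 : ℂ) • τ) =
        e * evenProd k l τ * oddJacobian A B ((2 : ℂ) • τ)) :
    RosenhainOnLead k l := by
  obtain ⟨ε, hε, h⟩ := hbase.exists_sign
  refine ⟨⟨e * ε, ?_, fun τ hτ => ?_⟩⟩
  · rcases he with rfl | rfl <;> rcases hε with rfl | rfl <;> norm_num
  · apply mul_right_cancel₀ (hne hτ.two_smul.evenNonvanishing)
    rw [hmul hτ.posIm hτ.evenNonvanishing, h _ hτ.two_smul]
    ring

lemma oddJacobian_swap (k l : Fin 6) (τ : Matrix (Fin 2) (Fin 2) ℂ) :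
    oddJacobian l k τ = -oddJacobian k l τ := by
  simp only [oddJacobian]
  ring

lemma evenProd_swap (k l : Fin 6) (τ : Matrix (Fin 2) (Fin 2) ℂ) :
    evenProd l k τ = evenProd k l τ := by
  simp only [evenProd, evenNull, and_comm (a := _ ≠ l), add_comm (oddChar l).1,
    add_comm (oddChar l).2.1, add_comm (oddChar l).2.2.1, add_comm (oddChar l).2.2.2]

lemma RosenhainOnLead.symm {k l : Fin 6} (h : RosenhainOnLead k l) : RosenhainOnLead l k := by
  obtain ⟨ε, hε, h⟩ := h.exists_sign
  refine ⟨⟨-ε, by rcases hε with rfl | rfl <;> norm_num, fun τ hτ => ?_⟩⟩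
  rw [oddJacobian_swap, evenProd_swap, h τ hτ]
  ring

lemma rosenhainOnLead_of_lt {k l : Fin 6} (hkl : k < l) : RosenhainOnLead k l := by
  have h04 : RosenhainOnLead 0 4 := ⟨⟨-1, .inr rfl, fun _ => oddJacobian_0_4⟩⟩
  have h13 : RosenhainOnLead 1 3 := ⟨⟨1, .inl rfl, fun _ => oddJacobian_1_3⟩⟩
  have h25 : RosenhainOnLead 2 5 := ⟨⟨1, .inl rfl, fun _ => oddJacobian_2_5⟩⟩
  have h01 : RosenhainOnLead 0 1 := .of_mul (.inr rfl) h04 evenProd_0_4_ne_zero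
    fun hτ h => oddJacobian_0_1_mul hτ (h.one_zero 0) (h.one_zero 1)
  have h02 : RosenhainOnLead 0 2 := .of_mul (.inl rfl) h13 evenProd_1_3_ne_zero
    fun hτ h => oddJacobian_0_2_mul hτ (h.one_zero 1) (h.zero_one 1)
  have h03 : RosenhainOnLead 0 3 := .of_mul (.inl rfl) h13 evenProd_1_3_ne_zero
    fun hτ h => oddJacobian_0_3_mul hτ (h.one_zero 1) (h.zero_one 0)
  have h05 : RosenhainOnLead 0 5 := .of_mul (.inr rfl) h04 evenProd_0_4_ne_zero
    fun hτ h => oddJacobian_0_5_mul hτ (h.one_zero 0) (h.one_one 1)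
  have h12 : RosenhainOnLead 1 2 := .of_mul (.inl rfl) h13 evenProd_1_3_ne_zero
    fun hτ h => oddJacobian_1_2_mul hτ (h.one_zero 0) (h.zero_one 1)
  have h14 : RosenhainOnLead 1 4 := .of_mul (.inl rfl) h04 evenProd_0_4_ne_zero
    fun hτ h => oddJacobian_1_4_mul hτ (h.one_zero 1) (h.one_one 0)
  have h15 : RosenhainOnLead 1 5 := .of_mul (.inr rfl) h04 evenProd_0_4_ne_zero
    fun hτ h => oddJacobian_1_5_mul hτ (h.one_zero 1) (h.one_one 1)
  have h23 : RosenhainOnLead 2 3 := .of_mul (.inr rfl) h25 evenProd_2_5_ne_zero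
    fun hτ h => oddJacobian_2_3_mul hτ (h.zero_one 0) (h.zero_one 1)
  have h24 : RosenhainOnLead 2 4 := .of_mul (.inr rfl) h25 evenProd_2_5_ne_zero
    fun hτ h => oddJacobian_2_4_mul hτ (h.zero_one 0) (h.one_one 1)
  have h34 : RosenhainOnLead 3 4 := .of_mul (.inr rfl) h25 evenProd_2_5_ne_zero
    fun hτ h => oddJacobian_3_4_mul hτ (h.zero_one 1) (h.one_one 1)
  have h35 : RosenhainOnLead 3 5 := .of_mul (.inl rfl) h25 evenProd_2_5_ne_zero
    fun hτ h => oddJacobian_3_5_mul hτ (h.zero_one 1) (h.one_one 0)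
  have h45 : RosenhainOnLead 4 5 := .of_mul (.inr rfl) h04 evenProd_0_4_ne_zero
    fun hτ h => oddJacobian_4_5_mul hτ (h.one_one 0) (h.one_one 1)
  fin_cases k <;> fin_cases l <;> first | exact absurd hkl (by decide) | assumption

lemma rosenhainOnLead {k l : Fin 6} (hkl : k ≠ l) : RosenhainOnLead k l :=
  hkl.lt_or_gt.elim rosenhainOnLead_of_lt fun h => (rosenhainOnLead_of_lt h).symm

lemma exists_sign_oddJacobian_eq {k l : Fin 6} (hkl : k ≠ l) :
    ∃ ε : ℂ, (ε = 1 ∨ ε = -1) ∧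
      ∀ τ, PosIm τ → oddJacobian k l τ = ε * (Real.pi : ℂ) ^ 2 * evenProd k l τ := by
  obtain ⟨ε, hε, h⟩ := (rosenhainOnLead hkl).exists_sign
  refine ⟨ε, hε, fun τ hτ => ?_⟩
  obtain ⟨δ, hδ, hray⟩ := hτ.exists_siegelRay
  obtain ⟨R, hR, hlead⟩ := exists_leadRegion
  obtain ⟨s₀, hs₀, hdom⟩ := hτ.exists_leadDominant hR
  have hD := fun i m => differentiableOn_thetaDeriv_siegelRay hray i (oddChar m).1
    (oddChar m).2.1 (oddChar m).2.2.1 (oddChar m).2.2.2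
  have key := eqOn_of_eventuallyEq_siegelRay (f := fun s => oddJacobian k l (siegelRay τ s))
    (g := fun s => ε * (Real.pi : ℂ) ^ 2 * evenProd k l (siegelRay τ s)) hδ hs₀
    (((hD 0 k).mul (hD 1 l)).sub ((hD 1 k).mul (hD 0 l)))
    (.const_mul (.fun_finsetProd fun m _ => differentiableOn_thetaNull_siegelRay hray _ _ _ _) _)
    fun s hs => h _ (hlead _ (hdom s hs))
  simpa only [siegelRay_zero] using key

lemma fract_intCast_div_two (n : ℤ) : Int.fract ((n : ℝ) / 2) = ((n % 2 : ℤ) : ℝ) / 2 := by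
  rw [Int.fract_eq_iff]
  have h0 := Int.emod_nonneg n two_ne_zero
  have h1 := Int.emod_lt_of_pos n two_pos
  refine ⟨by positivity, ?_, n / 2, ?_⟩
  · have : ((n % 2 : ℤ) : ℝ) < 2 := by exact_mod_cast h1
    linarith
  · have : (n : ℝ) = (2 * (n / 2) + n % 2 : ℤ) := by rw [Int.mul_ediv_add_emod]
    rw [this]
    push_cast
    ring

lemma charSub_charAdd_halfChar (a₀ a₁ b₀ b₁ a₀' a₁' b₀' b₁' a₀'' a₁'' b₀'' b₁'' : ℤ) :
    charSub (charAdd (halfChar a₀ a₁ b₀ b₁) (halfChar a₀' a₁' b₀' b₁'))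
        (halfChar a₀'' a₁'' b₀'' b₁'') =
      halfChar ((a₀ + a₀' - a₀'') % 2) ((a₁ + a₁' - a₁'') % 2) ((b₀ + b₀' - b₀'') % 2)
        ((b₁ + b₁' - b₁'') % 2) := by
  have h : ∀ a b c : ℤ, Int.fract (Int.fract ((a : ℝ) / 2 + b / 2) - c / 2) =
      (((a + b - c) % 2 : ℤ) : ℝ) / 2 := fun a b c => by
    rw [← fract_intCast_div_two, Int.fract_eq_fract]
    refine ⟨-⌊(a : ℝ) / 2 + b / 2⌋, ?_⟩
    rw [Int.fract]
    push_cast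
    ring
  simp only [charSub, charAdd, halfChar]
  ext i <;> fin_cases i <;> exact h _ _ _

/-- The `k`-th odd characteristic. -/
def oddHalfChar (k : Fin 6) : ThetaChar 2 :=
  halfChar (oddChar k).1 (oddChar k).2.1 (oddChar k).2.2.1 (oddChar k).2.2.2

lemma exists_eq_oddHalfChar {η : ThetaChar 2} (hchar : IsChar η) (hodd : IsOddChar η) :
    ∃ k, η = oddHalfChar k := by
  have hval : ∀ x : ℝ, x = 0 ∨ x = 1 / 2 → ∃ a : ℤ, (a = 0 ∨ a = 1) ∧ x = a / 2 := by
    rintro x (rfl | rfl)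
    exacts [⟨0, .inl rfl, by norm_num⟩, ⟨1, .inr rfl, by norm_num⟩]
  obtain ⟨a₀, ha₀, h1⟩ := hval _ (hchar.1 0)
  obtain ⟨a₁, ha₁, h2⟩ := hval _ (hchar.1 1)
  obtain ⟨b₀, hb₀, h3⟩ := hval _ (hchar.2 0)
  obtain ⟨b₁, hb₁, h4⟩ := hval _ (hchar.2 1)
  have hη : η = halfChar a₀ a₁ b₀ b₁ := by
    ext i <;> fin_cases i <;> assumption
  have hne : ∀ c : ℤ, a₀ * b₀ + a₁ * b₁ ≠ 2 * c := by
    refine fun c hc => hodd ⟨c, ?_⟩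
    have hc' : (a₀ * b₀ + a₁ * b₁ : ℝ) = 2 * c := by exact_mod_cast hc
    rw [Fin.sum_univ_two, h1, h2, h3, h4]
    linear_combination hc'
  have hex : ∃ k, oddChar k = (a₀, a₁, b₀, b₁) := by
    have h0 := hne 0
    have h1 := hne 1
    clear hne h2 h3 h4 hη
    rcases ha₀ with rfl | rfl <;> rcases ha₁ with rfl | rfl <;> rcases hb₀ with rfl | rfl <;>
      rcases hb₁ with rfl | rfl <;> first | exact absurd rfl h0 | exact absurd rfl h1 | decide
  obtain ⟨k, hk⟩ := hex
  exact ⟨k, by rw [hη, oddHalfChar, hk]⟩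

lemma jacobianNullwert_oddHalfChar (k l : Fin 6) (τ : Matrix (Fin 2) (Fin 2) ℂ) :
    jacobianNullwert ![oddHalfChar k, oddHalfChar l] τ = oddJacobian k l τ :=
  Matrix.det_fin_two _

lemma prod_theta_oddHalfChar (k l : Fin 6) (τ : Matrix (Fin 2) (Fin 2) ℂ) :
    ∏ m ∈ Finset.univ.filter (fun m : Fin 6 => m ≠ k ∧ m ≠ l),
        theta (charSub (charAdd (oddHalfChar k) (oddHalfChar l)) (oddHalfChar m)) 0 τ =
      evenProd k l τ := by
  simp only [oddHalfChar, charSub_charAdd_halfChar, evenProd, evenNull, thetaNull]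

/-- **Rosenhain's formula.** Let `η₁,…,η₆` be the six odd analytic theta
characteristics in dimension `g = 2`. For every pair of distinct indices `k, l`
there is a sign `ε ∈ {+1, -1}` such that for all `τ ∈ H₂`,
`J(η_k, η_l)(τ) = ε·π²·∏_{m ≠ k,l} θ[η_k + η_l - η_m](0; τ)`. -/
theorem rosenhain (η : Fin 6 → ThetaChar 2) (hinj : Function.Injective η)
    (hchar : ∀ k, IsChar (η k)) (hodd : ∀ k, IsOddChar (η k))
    (k l : Fin 6) (hkl : k ≠ l) :
    ∃ ε : ℂ, (ε = 1 ∨ ε = -1) ∧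
      ∀ τ : Matrix (Fin 2) (Fin 2) ℂ, IsSiegel τ →
        jacobianNullwert ![η k, η l] τ =
          ε * (Real.pi : ℂ) ^ 2 *
            ∏ m ∈ Finset.univ.filter (fun m : Fin 6 => m ≠ k ∧ m ≠ l),
              theta (charSub (charAdd (η k) (η l)) (η m)) 0 τ := by
  choose φ hφ using fun m => exists_eq_oddHalfChar (hchar m) (hodd m)
  have hφinj : Function.Injective φ := fun i j hij => hinj (by rw [hφ, hφ, hij])
  let e : Fin 6 ≃ Fin 6 := Equiv.ofBijective φ (Finite.injective_iff_bijective.1 hφinj)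
  obtain ⟨ε, hε, h⟩ := exists_sign_oddJacobian_eq (hφinj.ne hkl)
  refine ⟨ε, hε, fun τ hτ => ?_⟩
  simp only [hφ]
  rw [jacobianNullwert_oddHalfChar, h τ hτ.posIm, ← prod_theta_oddHalfChar]
  congr 1
  refine (Finset.prod_equiv e (fun m => ?_) fun m _ => rfl).symm
  simp [e, hφinj.eq_iff]

end
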